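/- Let X be a Banach space and Γ : [0,1] → cwk(X) a variationally Henstock integrable multifunction. The following are equivalent: (a) every variationally Henstock integrable selection of Γ is McShane integrable; (b) every variationally Henstock integrable selection of Γ is Pettis integrable; (c) Γ possesses at least one Pettis integrable selection; (d) Γ is Pettis integrable; (e) Γ is McShane integrable. -/

import Mathlib

open Set Metric MeasureTheory Pointwise
open scoped ENNReal NNReal

namespace GaugePaper

variable (X : Type*) [NormedAddCommGroup X] [NormedSpace ℝ X]

/-- `A ∈ cwk(X)`: `A` is a nonempty, convex and weakly compact subset of `X`. -/
def IsCWK (A : Set X) : Prop :=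
  A.Nonempty ∧ Convex ℝ A ∧ IsCompact (toWeakSpace ℝ X '' A)

variable {X}

/-- The support function `σ(x*, A)`. -/
noncomputable def suppFn (x' : X →L[ℝ] ℝ) (A : Set X) : ℝ := sSup (x' '' A)

/-- `‖A‖ = sup {‖x‖ : x ∈ A}`. -/
noncomputable def setNorm (A : Set X) : ℝ := sSup ((fun x => ‖x‖) '' A)

/-- A gauge on `[0,1]`: a positive function. -/
def IsGauge (δ : ℝ → ℝ) : Prop := ∀ t ∈ Icc (0:ℝ) 1, 0 < δ t

/-- A tagged partition of `[0,1]` into `n` (possibly degenerate) nonoverlapping closed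
subintervals `[pt i, pt (i+1)]`, with tags `tag i ∈ [0,1]`. -/
structure TP (n : ℕ) where
  pt : Fin (n + 1) → ℝ
  tag : Fin n → ℝ
  mono : Monotone pt
  first : pt 0 = 0
  last : pt (Fin.last n) = 1
  tagMem : ∀ i, tag i ∈ Icc (0:ℝ) 1

namespace TP

variable {n : ℕ} (P : TP n)

/-- The `i`-th subinterval of the partition. -/
def ivl (i : Fin n) : Set ℝ := Icc (P.pt i.castSucc) (P.pt i.succ)

/-- The length `|I_i|` of the `i`-th subinterval. -/
def len (i : Fin n) : ℝ := P.pt i.succ - P.pt i.castSucc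

/-- A Perron (Henstock) partition: each tag belongs to its interval. -/
def IsPerron : Prop := ∀ i, P.tag i ∈ P.ivl i

/-- `δ`-fineness: `I_i ⊆ (t_i - δ(t_i), t_i + δ(t_i))`. -/
def IsFine (δ : ℝ → ℝ) : Prop :=
  ∀ i, P.ivl i ⊆ Ioo (P.tag i - δ (P.tag i)) (P.tag i + δ (P.tag i))

/-- An interior Henstock partition: each tag is in the interior of its interval, except
possibly for intervals containing `0` or `1`, where the tag may also be `0` or `1`. -/
def IsInterior : Prop :=
  ∀ i, P.tag i ∈ Ioo (P.pt i.castSucc) (P.pt i.succ) ∨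
    (((0:ℝ) ∈ P.ivl i ∨ (1:ℝ) ∈ P.ivl i) ∧ P.tag i ∈ P.ivl i ∩ ({0, 1} : Set ℝ))

end TP

/-- Riemann sum of a multifunction: `∑ i |I_i| • Γ(t_i)` (Minkowski sums). -/
def mSum {n : ℕ} (P : TP n) (Γ : ℝ → Set X) : Set X :=
  ∑ i : Fin n, P.len i • Γ (P.tag i)

/-- Riemann sum of a function: `∑ i |I_i| • f(t_i)`. -/
def fSum {n : ℕ} (P : TP n) (f : ℝ → X) : X :=
  ∑ i : Fin n, P.len i • f (P.tag i)

/-! ### Gauge integrals of multifunctions -/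

/-- Henstock integrability of a multifunction `Γ : [0,1] → cwk(X)`. -/
def HenstockIntegrable (Γ : ℝ → Set X) : Prop :=
  ∃ I : Set X, IsCWK X I ∧ ∀ ε > 0, ∃ δ : ℝ → ℝ, IsGauge δ ∧
    ∀ (n : ℕ) (P : TP n), P.IsPerron → P.IsFine δ → hausdorffDist I (mSum P Γ) < ε

/-- McShane integrability of a multifunction (free tags). -/
def McShaneIntegrable (Γ : ℝ → Set X) : Prop :=
  ∃ I : Set X, IsCWK X I ∧ ∀ ε > 0, ∃ δ : ℝ → ℝ, IsGauge δ ∧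
    ∀ (n : ℕ) (P : TP n), P.IsFine δ → hausdorffDist I (mSum P Γ) < ε

/-- `ℋ`-integrability: Henstock integrability with Lebesgue measurable gauges. -/
def HMeasIntegrable (Γ : ℝ → Set X) : Prop :=
  ∃ I : Set X, IsCWK X I ∧ ∀ ε > 0, ∃ δ : ℝ → ℝ, IsGauge δ ∧ AEMeasurable δ volume ∧
    ∀ (n : ℕ) (P : TP n), P.IsPerron → P.IsFine δ → hausdorffDist I (mSum P Γ) < ε

/-- Birkhoff (`ℳ`-) integrability: McShane integrability with Lebesgue measurable gauges. -/
def BirkhoffIntegrable (Γ : ℝ → Set X) : Prop :=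
  ∃ I : Set X, IsCWK X I ∧ ∀ ε > 0, ∃ δ : ℝ → ℝ, IsGauge δ ∧ AEMeasurable δ volume ∧
    ∀ (n : ℕ) (P : TP n), P.IsFine δ → hausdorffDist I (mSum P Γ) < ε

/-! ### Gauge integrals of (single-valued) functions -/

/-- Henstock integrability of a function `f : [0,1] → X`. -/
def FHenstockIntegrable (f : ℝ → X) : Prop :=
  ∃ w : X, ∀ ε > 0, ∃ δ : ℝ → ℝ, IsGauge δ ∧
    ∀ (n : ℕ) (P : TP n), P.IsPerron → P.IsFine δ → ‖w - fSum P f‖ < ε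

/-- McShane integrability of a function. -/
def FMcShaneIntegrable (f : ℝ → X) : Prop :=
  ∃ w : X, ∀ ε > 0, ∃ δ : ℝ → ℝ, IsGauge δ ∧
    ∀ (n : ℕ) (P : TP n), P.IsFine δ → ‖w - fSum P f‖ < ε

/-- `ℋ`-integrability of a function: measurable gauges. -/
def FHMeasIntegrable (f : ℝ → X) : Prop :=
  ∃ w : X, ∀ ε > 0, ∃ δ : ℝ → ℝ, IsGauge δ ∧ AEMeasurable δ volume ∧
    ∀ (n : ℕ) (P : TP n), P.IsPerron → P.IsFine δ → ‖w - fSum P f‖ < ε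

/-- Birkhoff (`ℳ`-) integrability of a function: McShane with measurable gauges. -/
def FBirkhoffIntegrable (f : ℝ → X) : Prop :=
  ∃ w : X, ∀ ε > 0, ∃ δ : ℝ → ℝ, IsGauge δ ∧ AEMeasurable δ volume ∧
    ∀ (n : ℕ) (P : TP n), P.IsFine δ → ‖w - fSum P f‖ < ε

/-- Henstock–Kurzweil integrability of a real-valued function on `[0,1]`. -/
def HKIntegrable (g : ℝ → ℝ) : Prop :=
  ∃ A : ℝ, ∀ ε > 0, ∃ δ : ℝ → ℝ, IsGauge δ ∧
    ∀ (n : ℕ) (P : TP n), P.IsPerron → P.IsFine δ → |fSum P g - A| < ε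

/-! ### Pettis integrals -/

/-- Pettis integrability of a function `f : [0,1] → X`. -/
def FPettisIntegrable (f : ℝ → X) : Prop :=
  (∀ x' : X →L[ℝ] ℝ, IntegrableOn (fun t => x' (f t)) (Icc (0:ℝ) 1) volume) ∧
  ∀ E ⊆ Icc (0:ℝ) 1, NullMeasurableSet E volume →
    ∃ ν : X, ∀ x' : X →L[ℝ] ℝ, x' ν = ∫ t in E, x' (f t)

/-- Pettis integrability of a multifunction `Γ : [0,1] → cwk(X)`. -/
def PettisIntegrable (Γ : ℝ → Set X) : Prop :=
  (∀ x' : X →L[ℝ] ℝ, IntegrableOn (fun t => suppFn x' (Γ t)) (Icc (0:ℝ) 1) volume) ∧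
  ∀ E ⊆ Icc (0:ℝ) 1, NullMeasurableSet E volume →
    ∃ W : Set X, IsCWK X W ∧ ∀ x' : X →L[ℝ] ℝ, suppFn x' W = ∫ t in E, suppFn x' (Γ t)

/-- `f` is a selection of `Γ`. -/
def Selection (Γ : ℝ → Set X) (f : ℝ → X) : Prop := ∀ t ∈ Icc (0:ℝ) 1, f t ∈ Γ t

/-! ### Variational integrals -/

/-- Finite additivity of an interval multifunction on subintervals of `[0,1]`
(an interval `[a,b] ⊆ [0,1]` is encoded by its endpoints). -/
def AdditiveIntervalMF (Φ : ℝ → ℝ → Set X) : Prop :=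
  ∀ a b c : ℝ, 0 ≤ a → a ≤ b → b ≤ c → c ≤ 1 → Φ a c = Φ a b + Φ b c

/-- Finite additivity of a vector-valued interval function on subintervals of `[0,1]`. -/
def AdditiveIntervalF (Φ : ℝ → ℝ → X) : Prop :=
  ∀ a b c : ℝ, 0 ≤ a → a ≤ b → b ≤ c → c ≤ 1 → Φ a c = Φ a b + Φ b c

/-- `Φ` is a variational Henstock primitive of the multifunction `Γ`. -/
def vHPrimitive (Γ : ℝ → Set X) (Φ : ℝ → ℝ → Set X) : Prop :=
  (∀ a b : ℝ, 0 ≤ a → a ≤ b → b ≤ 1 → IsCWK X (Φ a b)) ∧ AdditiveIntervalMF Φ ∧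
  ∀ ε > 0, ∃ δ : ℝ → ℝ, IsGauge δ ∧ ∀ (n : ℕ) (P : TP n), P.IsPerron → P.IsFine δ →
    ∑ i : Fin n, hausdorffDist (Φ (P.pt i.castSucc) (P.pt i.succ)) (P.len i • Γ (P.tag i)) < ε

/-- Variational Henstock integrability of a multifunction. -/
def vHIntegrable (Γ : ℝ → Set X) : Prop := ∃ Φ : ℝ → ℝ → Set X, vHPrimitive Γ Φ

/-- Variational McShane integrability of a multifunction (free tags). -/
def vMSIntegrable (Γ : ℝ → Set X) : Prop :=
  ∃ Φ : ℝ → ℝ → Set X,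
    (∀ a b : ℝ, 0 ≤ a → a ≤ b → b ≤ 1 → IsCWK X (Φ a b)) ∧ AdditiveIntervalMF Φ ∧
    ∀ ε > 0, ∃ δ : ℝ → ℝ, IsGauge δ ∧ ∀ (n : ℕ) (P : TP n), P.IsFine δ →
      ∑ i : Fin n, hausdorffDist (Φ (P.pt i.castSucc) (P.pt i.succ)) (P.len i • Γ (P.tag i)) < ε

/-- Variational `ℋ`-integrability of a multifunction: measurable gauges. -/
def vHMeasIntegrable (Γ : ℝ → Set X) : Prop :=
  ∃ Φ : ℝ → ℝ → Set X,
    (∀ a b : ℝ, 0 ≤ a → a ≤ b → b ≤ 1 → IsCWK X (Φ a b)) ∧ AdditiveIntervalMF Φ ∧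
    ∀ ε > 0, ∃ δ : ℝ → ℝ, IsGauge δ ∧ AEMeasurable δ volume ∧
      ∀ (n : ℕ) (P : TP n), P.IsPerron → P.IsFine δ →
        ∑ i : Fin n, hausdorffDist (Φ (P.pt i.castSucc) (P.pt i.succ)) (P.len i • Γ (P.tag i)) < ε

/-- `Φ` is a variational Henstock primitive of the function `f`. -/
def FvHPrimitive (f : ℝ → X) (Φ : ℝ → ℝ → X) : Prop :=
  AdditiveIntervalF Φ ∧
  ∀ ε > 0, ∃ δ : ℝ → ℝ, IsGauge δ ∧ ∀ (n : ℕ) (P : TP n), P.IsPerron → P.IsFine δ →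
    ∑ i : Fin n, ‖Φ (P.pt i.castSucc) (P.pt i.succ) - P.len i • f (P.tag i)‖ < ε

/-- Variational Henstock integrability of a function. -/
def FvHIntegrable (f : ℝ → X) : Prop := ∃ Φ : ℝ → ℝ → X, FvHPrimitive f Φ

/-- Variational McShane integrability of a function (free tags). -/
def FvMSIntegrable (f : ℝ → X) : Prop :=
  ∃ Φ : ℝ → ℝ → X, AdditiveIntervalF Φ ∧
    ∀ ε > 0, ∃ δ : ℝ → ℝ, IsGauge δ ∧ ∀ (n : ℕ) (P : TP n), P.IsFine δ →
      ∑ i : Fin n, ‖Φ (P.pt i.castSucc) (P.pt i.succ) - P.len i • f (P.tag i)‖ < ε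

/-- Variational `ℋ`-integrability of a function: measurable gauges. -/
def FvHMeasIntegrable (f : ℝ → X) : Prop :=
  ∃ Φ : ℝ → ℝ → X, AdditiveIntervalF Φ ∧
    ∀ ε > 0, ∃ δ : ℝ → ℝ, IsGauge δ ∧ AEMeasurable δ volume ∧
      ∀ (n : ℕ) (P : TP n), P.IsPerron → P.IsFine δ →
        ∑ i : Fin n, ‖Φ (P.pt i.castSucc) (P.pt i.succ) - P.len i • f (P.tag i)‖ < ε

/-! ### Partial Perron partitions and variational measures -/

/-- A finite tagged Perron family of `n` nonoverlapping closed subintervals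
`[a i, b i]` of `[0,1]` (a "partition in `[0,1]`", not necessarily covering it). -/
structure PTP (n : ℕ) where
  a : Fin n → ℝ
  b : Fin n → ℝ
  tag : Fin n → ℝ
  le : ∀ i, a i ≤ b i
  sub : ∀ i, Icc (a i) (b i) ⊆ Icc (0:ℝ) 1
  nonoverlap : ∀ i j, i ≠ j → (Icc (a i) (b i) ∩ Icc (a j) (b j)).Subsingleton
  perron : ∀ i, tag i ∈ Icc (a i) (b i)

/-- `δ`-fineness of a partial Perron family. -/
def PTP.IsFine {n : ℕ} (P : PTP n) (δ : ℝ → ℝ) : Prop :=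
  ∀ i, Icc (P.a i) (P.b i) ⊆ Ioo (P.tag i - δ (P.tag i)) (P.tag i + δ (P.tag i))

/-- `Var(Ψ, δ, E)` for a scalar interval function `Ψ`. -/
noncomputable def scVar (Ψ : ℝ → ℝ → ℝ) (δ : ℝ → ℝ) (E : Set ℝ) : ℝ≥0∞ :=
  ⨆ (n : ℕ) (P : PTP n) (_ : P.IsFine δ ∧ ∀ i, P.tag i ∈ E),
    ∑ i : Fin n, ENNReal.ofReal |Ψ (P.a i) (P.b i)|

/-- The variational measure `V_Ψ(E)` generated by a scalar interval function `Ψ`. -/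
noncomputable def scVarMeasure (Ψ : ℝ → ℝ → ℝ) (E : Set ℝ) : ℝ≥0∞ :=
  ⨅ (δ : ℝ → ℝ) (_ : IsGauge δ), scVar Ψ δ E

section

open Filter Topology

variable {Y : Type*} [NormedAddCommGroup Y] [NormedSpace ℝ Y]

/-! ### Cousin's lemma and the construction of tagged partitions -/

/-- Cousin's lemma: a property of intervals that is additive and holds for all small intervals
around each point holds for the whole interval. -/
theorem cousin {Q : ℝ → ℝ → Prop} {a b : ℝ} (hab : a ≤ b)
    (hadd : ∀ x y z, a ≤ x → x ≤ y → y ≤ z → z ≤ b → Q x y → Q y z → Q x z)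
    (hloc : ∀ t ∈ Icc a b, ∃ r > 0, ∀ x y, a ≤ x → x ≤ t → t ≤ y → y ≤ b →
      t - r < x → y < t + r → Q x y) : Q a b := by
  set S : Set ℝ := {x | x ∈ Icc a b ∧ Q a x} with hS
  have haS : a ∈ S := by
    obtain ⟨r, hr, h⟩ := hloc a ⟨le_rfl, hab⟩
    exact ⟨⟨le_rfl, hab⟩, h a a le_rfl le_rfl le_rfl hab (by linarith) (by linarith)⟩
  have hbdd : BddAbove S := ⟨b, fun x hx => hx.1.2⟩
  set c := sSup S with hc
  have hac : a ≤ c := le_csSup hbdd haS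
  have hcb : c ≤ b := csSup_le ⟨a, haS⟩ fun x hx => hx.1.2
  obtain ⟨r, hr, h⟩ := hloc c ⟨hac, hcb⟩
  obtain ⟨s, hs, hsc⟩ := exists_lt_of_lt_csSup ⟨a, haS⟩ (show c - r < sSup S by linarith)
  have hsc' : s ≤ c := le_csSup hbdd hs
  have hQ : Q a (min (c + r / 2) b) := by
    have hy : c ≤ min (c + r / 2) b := le_min (by linarith) hcb
    refine hadd a s _ le_rfl hs.1.1 (hsc'.trans hy) (min_le_right _ _) hs.2 ?_
    refine h s _ hs.1.1 hsc' hy (min_le_right _ _) hsc ?_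
    exact (min_le_left _ _).trans_lt (by linarith)
  rcases le_total b (c + r / 2) with h1 | h1
  · rwa [min_eq_right h1] at hQ
  · rw [min_eq_left h1] at hQ
    have : c + r / 2 ≤ c := le_csSup hbdd ⟨⟨by linarith, h1⟩, hQ⟩
    linarith

/-- `Att R F a b s`: the sum `s` of `F x y t` is attained along a chain of intervals `[x, y]` with
tags `t` leading from `a` to `b`, each of which satisfies `R x y t`. -/
inductive Att {M : Type*} [AddCommMonoid M] (R : ℝ → ℝ → ℝ → Prop) (F : ℝ → ℝ → ℝ → M) :
    ℝ → ℝ → M → Prop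
  | nil (a : ℝ) : Att R F a a 0
  | snoc {a b c t : ℝ} {s : M} : Att R F a b s → b ≤ c → R b c t → Att R F a c (s + F b c t)

namespace Att

variable {M : Type*} [AddCommMonoid M] {R : ℝ → ℝ → ℝ → Prop} {F : ℝ → ℝ → ℝ → M}

theorem single {a b t : ℝ} (hab : a ≤ b) (h : R a b t) : Att R F a b (F a b t) := by
  simpa using (Att.nil (F := F) a).snoc hab h

theorem trans {a b c : ℝ} {s s' : M} (h : Att R F a b s) (h' : Att R F b c s') :
    Att R F a c (s + s') := by
  induction h' with
  | nil => simpa using h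
  | snoc _ hbc hR ih => rw [← add_assoc]; exact ih.snoc hbc hR

theorem exists_seq {a b : ℝ} {s : M} (h : Att R F a b s) :
    ∃ (n : ℕ) (pt tag : ℕ → ℝ), pt 0 = a ∧ pt n = b ∧
      (∀ i < n, pt i ≤ pt (i + 1) ∧ R (pt i) (pt (i + 1)) (tag i)) ∧
      ∑ i ∈ Finset.range n, F (pt i) (pt (i + 1)) (tag i) = s := by
  induction h with
  | nil => exact ⟨0, fun _ => _, fun _ => 0, rfl, rfl, by simp, by simp⟩
  | @snoc b c t s _ hbc hR ih =>
    obtain ⟨n, pt, tag, h0, hn, hi, hs⟩ := ih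
    refine ⟨n + 1, fun i => if i ≤ n then pt i else c, fun i => if i < n then tag i else t,
      by simpa using h0, by simp, fun i hin => ?_, ?_⟩
    · rcases Nat.lt_succ_iff_lt_or_eq.1 hin with h | rfl
      · simpa [h, h.le, Nat.succ_le_of_lt h] using hi i h
      · simpa [hn] using ⟨hbc, hR⟩
    · rw [Finset.sum_range_succ, ← hs]
      congr 1
      · refine Finset.sum_congr rfl fun i hin => ?_
        have h := Finset.mem_range.1 hin
        simp [h, h.le, Nat.succ_le_of_lt h]
      · simp [hn]

theorem exists_TP (hR : ∀ x y t, R x y t → t ∈ Icc (0 : ℝ) 1) {s : M} (h : Att R F 0 1 s) :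
    ∃ (n : ℕ) (P : TP n), (∀ i : Fin n, R (P.pt i.castSucc) (P.pt i.succ) (P.tag i)) ∧
      ∑ i : Fin n, F (P.pt i.castSucc) (P.pt i.succ) (P.tag i) = s := by
  obtain ⟨n, pt, tag, h0, hn, hi, hs⟩ := h.exists_seq
  refine ⟨n, ⟨fun i => pt i, fun i => tag i, ?_, by simpa using h0, by simpa using hn,
    fun i => hR _ _ _ (hi i i.2).2⟩, fun i => by simpa using (hi i i.2).2, ?_⟩
  · exact Fin.monotone_iff_le_succ.2 fun i => by simpa using (hi i i.2).1
  · rw [← hs, Finset.sum_range]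
    simp

end Att

theorem TP.pt_nonneg {n : ℕ} (P : TP n) (i : Fin (n + 1)) : 0 ≤ P.pt i :=
  P.first ▸ P.mono (Fin.zero_le i)

theorem TP.pt_le_one {n : ℕ} (P : TP n) (i : Fin (n + 1)) : P.pt i ≤ 1 :=
  P.last ▸ P.mono (Fin.le_last i)

theorem TP.pt_le {n : ℕ} (P : TP n) (i : Fin n) : P.pt i.castSucc ≤ P.pt i.succ :=
  P.mono (Fin.castSucc_lt_succ).le

theorem TP.sum_sub {M : Type*} [AddCommGroup M] {n : ℕ} (P : TP n) (v : ℝ → M) :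
    ∑ i : Fin n, (v (P.pt i.succ) - v (P.pt i.castSucc)) = v 1 - v 0 := by
  have h : ∀ (m : ℕ) (u : Fin (m + 1) → M),
      ∑ i : Fin m, (u i.succ - u i.castSucc) = u (Fin.last m) - u 0 := by
    intro m
    induction m with
    | zero => intro u; simp
    | succ m ih =>
      intro u
      rw [Fin.sum_univ_castSucc]
      have := ih (fun i => u i.castSucc)
      simp only [Fin.castSucc_zero] at this
      simp only [Fin.succ_castSucc, this, Fin.succ_last]
      abel
  simpa [P.first, P.last] using h n fun i => v (P.pt i)

/-! ### Variational integrability through monotone majorants -/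

/-- The filter of small intervals `[x, y] ⊆ [0,1]` containing `t`, encoded by their endpoints. -/
def tagF (t : ℝ) : Filter (ℝ × ℝ) := 𝓝[Icc 0 t] t ×ˢ 𝓝[Icc t 1] t

theorem eventually_tagF {t : ℝ} {p : ℝ × ℝ → Prop} :
    (∀ᶠ I in tagF t, p I) ↔ ∃ r > 0, ∀ x y, 0 ≤ x → x ≤ t → t ≤ y → y ≤ 1 →
      t - r < x → y < t + r → p (x, y) := by
  have hb := (nhdsWithin_hasBasis (nhds_basis_Ioo_pos t) (Icc 0 t)).prod_same_index
    (nhdsWithin_hasBasis (nhds_basis_Ioo_pos t) (Icc t 1)) (fun {i j} hi hj =>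
      ⟨min i j, lt_min hi hj,
        inter_subset_inter_left _ (Ioo_subset_Ioo (by linarith [min_le_left i j])
          (by linarith [min_le_left i j])),
        inter_subset_inter_left _ (Ioo_subset_Ioo (by linarith [min_le_right i j])
          (by linarith [min_le_right i j]))⟩)
  rw [tagF, hb.eventually_iff]
  constructor
  · rintro ⟨r, hr, h⟩
    refine ⟨r, hr, fun x y h0 hx hy h1 hrx hry => h ⟨⟨⟨hrx, by linarith⟩, h0, hx⟩,
      ⟨⟨by linarith, hry⟩, hy, h1⟩⟩⟩
  · rintro ⟨r, hr, h⟩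
    refine ⟨r, hr, ?_⟩
    rintro ⟨x, y⟩ ⟨⟨⟨hrx, -⟩, h0, hx⟩, ⟨⟨-, hry⟩, hy, h1⟩⟩
    exact h x y h0 hx hy h1 hrx hry

theorem eventually_tagF_mem (t : ℝ) :
    ∀ᶠ I in tagF t, 0 ≤ I.1 ∧ I.1 ≤ t ∧ t ≤ I.2 ∧ I.2 ≤ 1 :=
  eventually_tagF.2 ⟨1, one_pos, fun _ _ h0 hx hy h1 _ _ => ⟨h0, hx, hy, h1⟩⟩

theorem eventually_tagF_subset {t : ℝ} {U : Set ℝ} (hU : U ∈ 𝓝 t) :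
    ∀ᶠ I in tagF t, Icc I.1 I.2 ⊆ U := by
  obtain ⟨r, hr, h⟩ := (nhds_basis_Ioo_pos t).mem_iff.1 hU
  exact eventually_tagF.2 ⟨r, hr, fun x y _ _ _ _ hx hy z hz =>
    h ⟨hx.trans_le hz.1, hz.2.trans_lt hy⟩⟩

/-- A form of Cousin's lemma for additive functions of intervals: if `G` is locally increasing at
every point then it increases. -/
theorem le_of_locally_le {G : ℝ → ℝ}
    (h : ∀ t ∈ Icc (0 : ℝ) 1, ∀ᶠ I in tagF t, G I.1 ≤ G I.2) : G 0 ≤ G 1 := by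
  refine cousin (Q := fun x y => G x ≤ G y) zero_le_one
    (fun x y z _ _ _ _ h h' => h.trans h') fun t ht => ?_
  exact eventually_tagF.1 (h t ht)



/-- `VH g P`: the function `P` on `[0,1]` is a variational Henstock primitive of `g`, expressed
through monotone majorants. -/
def VH (g P : ℝ → Y) : Prop :=
  ∀ ε > 0, ∃ v : ℝ → ℝ, MonotoneOn v (Icc 0 1) ∧ v 1 - v 0 ≤ ε ∧
    ∀ t ∈ Icc (0 : ℝ) 1, ∀ᶠ I in tagF t,
      ‖P I.2 - P I.1 - (I.2 - I.1) • g t‖ ≤ v I.2 - v I.1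

theorem FvHPrimitive.sub_eq {g : ℝ → Y} {φ : ℝ → ℝ → Y} (h : FvHPrimitive g φ) {a b : ℝ}
    (h0 : 0 ≤ a) (hab : a ≤ b) (hb : b ≤ 1) : φ a b = φ 0 b - φ 0 a := by
  rw [h.1 0 a b le_rfl h0 hab hb]; abel

theorem FvHPrimitive.vh {g : ℝ → Y} {φ : ℝ → ℝ → Y} (h : FvHPrimitive g φ) :
    VH g (φ 0) := by
  intro ε hε
  obtain ⟨δ, hδ, hδs⟩ := h.2 ε hε
  set R : ℝ → ℝ → ℝ → Prop := fun x y t =>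
    t ∈ Icc (0 : ℝ) 1 ∧ x ≤ t ∧ t ≤ y ∧ t - δ t < x ∧ y < t + δ t with hR
  set F : ℝ → ℝ → ℝ → ℝ := fun x y t => ‖φ x y - (y - x) • g t‖ with hF
  have hex : ∀ a b, 0 ≤ a → a ≤ b → b ≤ 1 → ∃ s, 0 ≤ s ∧ Att R F a b s := by
    intro a b h0 hab hb
    refine cousin (Q := fun x y => ∃ s, 0 ≤ s ∧ Att R F x y s) hab ?_ fun t ht => ?_
    · rintro x y z _ _ _ _ ⟨s, hs, h⟩ ⟨s', hs', h'⟩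
      exact ⟨s + s', add_nonneg hs hs', h.trans h'⟩
    · have ht' : t ∈ Icc (0 : ℝ) 1 := ⟨h0.trans ht.1, ht.2.trans hb⟩
      exact ⟨δ t, hδ t ht', fun x y _ hx hy _ hx' hy' =>
        ⟨_, norm_nonneg _, Att.single (hx.trans hy) ⟨ht', hx, hy, hx', hy'⟩⟩⟩
  have hlt : ∀ s, Att R F 0 1 s → s < ε := by
    intro s hs
    obtain ⟨n, P, hP, rfl⟩ := hs.exists_TP fun x y t h => h.1
    exact hδs n P (fun i => ⟨(hP i).2.1, (hP i).2.2.1⟩) fun i z hz =>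
      ⟨(hP i).2.2.2.1.trans_le hz.1, hz.2.trans_lt (hP i).2.2.2.2⟩
  have hbd : ∀ x, 0 ≤ x → x ≤ 1 → ∀ s, Att R F 0 x s → s ≤ ε := by
    intro x h0 h1 s hs
    obtain ⟨s', hs', h'⟩ := hex x 1 h0 h1 le_rfl
    linarith [hlt _ (hs.trans h')]
  have hbdd : ∀ x, 0 ≤ x → x ≤ 1 → BddAbove {s | Att R F 0 x s} :=
    fun x h0 h1 => ⟨ε, fun s hs => hbd x h0 h1 s hs⟩
  have key : ∀ x y s', 0 ≤ x → x ≤ y → y ≤ 1 → Att R F x y s' →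
      s' ≤ sSup {s | Att R F 0 y s} - sSup {s | Att R F 0 x s} := by
    intro x y s' h0 hxy h1 hs'
    obtain ⟨s₀, -, hs₀⟩ := hex 0 x le_rfl h0 (hxy.trans h1)
    rw [le_sub_iff_add_le, ← le_sub_iff_add_le']
    refine csSup_le ⟨s₀, hs₀⟩ fun s hs => ?_
    rw [le_sub_iff_add_le]
    exact le_csSup (hbdd y (h0.trans hxy) h1) (hs.trans hs')
  refine ⟨fun x => sSup {s | Att R F 0 x s}, fun x hx y hy hxy => ?_, ?_, fun t ht => ?_⟩
  · obtain ⟨s, hs, h⟩ := hex x y hx.1 hxy hy.2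
    have := key x y s hx.1 hxy hy.2 h
    simp only
    linarith
  · obtain ⟨s₀, -, hs₀⟩ := hex 0 1 le_rfl zero_le_one le_rfl
    have h1 : sSup {s | Att R F 0 1 s} ≤ ε := csSup_le ⟨s₀, hs₀⟩ fun s hs => (hlt s hs).le
    have h2 : 0 ≤ sSup {s | Att R F 0 0 s} :=
      le_csSup (hbdd 0 le_rfl zero_le_one) (Att.nil 0)
    simp only
    linarith
  · refine eventually_tagF.2 ⟨δ t, hδ t ht, fun x y h0 hx hy h1 hx' hy' => ?_⟩
    have hxy := hx.trans hy
    have := key x y _ h0 hxy h1 (Att.single hxy ⟨ht, hx, hy, hx', hy'⟩)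
    simpa [hF, ← h.sub_eq h0 hxy h1] using this

theorem VH.fvHPrimitive {g P : ℝ → Y} (h : VH g P) : FvHPrimitive g fun a b => P b - P a := by
  refine ⟨fun a b c _ _ _ _ => by simp, fun ε hε => ?_⟩
  obtain ⟨v, hv, hvε, hvI⟩ := h (ε / 2) (half_pos hε)
  choose! δ hδ hδv using fun t ht => eventually_tagF.1 (hvI t ht)
  refine ⟨δ, hδ, fun n T hT hTδ => ?_⟩
  calc _ ≤ ∑ i : Fin n, (v (T.pt i.succ) - v (T.pt i.castSucc)) := by
        refine Finset.sum_le_sum fun i _ => ?_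
        exact hδv _ (T.tagMem i) _ _ (T.pt_nonneg _) (hT i).1 (hT i).2 (T.pt_le_one _)
          (hTδ i ⟨le_rfl, T.pt_le i⟩).1 (hTδ i ⟨T.pt_le i, le_rfl⟩).2
    _ = v 1 - v 0 := T.sum_sub v
    _ < ε := by linarith

theorem eventually_nhds_of_tagF {t : ℝ} (ht : t ∈ Icc (0 : ℝ) 1) {p : ℝ × ℝ → Prop}
    (h : ∀ᶠ I in tagF t, p I) :
    ∀ᶠ x in 𝓝 t, x ∈ Icc (0 : ℝ) 1 → (x ≤ t → p (x, t)) ∧ (t ≤ x → p (t, x)) := by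
  obtain ⟨r, hr, h⟩ := eventually_tagF.1 h
  filter_upwards [Ioo_mem_nhds (show t - r < t by linarith) (show t < t + r by linarith)]
    with x hx hx1
  exact ⟨fun hxt => h x t hx1.1 hxt le_rfl ht.2 hx.1 (by linarith),
    fun hxt => h t x ht.1 le_rfl hxt hx1.2 (by linarith) hx.2⟩

/-- The straddle lemma. -/
theorem straddle {P : ℝ → Y} {y : Y} {t : ℝ} (h : HasDerivAt P y t) {ε : ℝ}
    (hε : 0 < ε) :
    ∀ᶠ I in tagF t, ‖P I.2 - P I.1 - (I.2 - I.1) • y‖ ≤ ε * (I.2 - I.1) := by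
  have h1 := (hasDerivAt_iff_isLittleO.1 h).def hε
  filter_upwards [eventually_tagF_subset h1, eventually_tagF_mem t] with I hI hm
  have hx := hI ⟨le_rfl, hm.2.1.trans hm.2.2.1⟩
  have hy := hI ⟨hm.2.1.trans hm.2.2.1, le_rfl⟩
  simp only [mem_ofPred_eq, Real.norm_eq_abs] at hx hy
  rw [abs_of_nonpos (by linarith)] at hx
  rw [abs_of_nonneg (by linarith)] at hy
  have : P I.2 - P I.1 - (I.2 - I.1) • y =
      (P I.2 - P t - (I.2 - t) • y) - (P I.1 - P t - (I.1 - t) • y) := by module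
  rw [this]
  refine (norm_sub_le _ _).trans ?_
  linarith

theorem exists_monotoneOn_tsum {v : ℕ → ℝ → ℝ} (hv : ∀ k, MonotoneOn (v k) (Icc 0 1)) {ε : ℝ}
    (h : ∀ k, v k 1 - v k 0 ≤ ε / 2 / 2 ^ k) :
    ∃ w : ℝ → ℝ, MonotoneOn w (Icc 0 1) ∧ w 1 - w 0 ≤ ε ∧
      ∀ k x y, 0 ≤ x → x ≤ y → y ≤ 1 → v k y - v k x ≤ w y - w x := by
  have h01 : (0 : ℝ) ∈ Icc (0 : ℝ) 1 := ⟨le_rfl, zero_le_one⟩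
  have h11 : (1 : ℝ) ∈ Icc (0 : ℝ) 1 := ⟨zero_le_one, le_rfl⟩
  have hle : ∀ k x, x ∈ Icc (0 : ℝ) 1 → v k x - v k 0 ≤ ε / 2 / 2 ^ k := fun k x hx =>
    (sub_le_sub_right (hv k hx h11 hx.2) _).trans (h k)
  have hs : ∀ x ∈ Icc (0 : ℝ) 1, Summable fun k => v k x - v k 0 := fun x hx =>
    Summable.of_nonneg_of_le (fun k => sub_nonneg.2 (hv k h01 hx hx.1)) (fun k => hle k x hx)
      (summable_geometric_two' ε)
  have key : ∀ k x y, 0 ≤ x → x ≤ y → y ≤ 1 →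
      v k y - v k x ≤ (∑' k, (v k y - v k 0)) - ∑' k, (v k x - v k 0) := by
    intro k x y h0 hxy h1
    have hx : x ∈ Icc (0 : ℝ) 1 := ⟨h0, hxy.trans h1⟩
    have hy : y ∈ Icc (0 : ℝ) 1 := ⟨h0.trans hxy, h1⟩
    rw [← (hs y hy).tsum_sub (hs x hx)]
    have := ((hs y hy).sub (hs x hx)).le_tsum k fun j _ => by
      simpa using hv j hx hy hxy
    simpa using this
  refine ⟨fun x => ∑' k, (v k x - v k 0), fun x hx y hy hxy => ?_, ?_, key⟩
  · have := hv 0 hx hy hxy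
    have := key 0 x y hx.1 hxy hy.2
    simp only
    linarith
  · simp only [sub_self, tsum_zero, sub_zero]
    calc _ ≤ ∑' k : ℕ, ε / 2 / 2 ^ k :=
          (hs 1 h11).tsum_le_tsum (fun k => h k) (summable_geometric_two' ε)
      _ = ε := tsum_geometric_two' ε

/-- Null sets are negligible even against arbitrarily large constants. -/
theorem exists_monotoneOn_of_null {N : Set ℝ} (hN : volume N = 0) {ε : ℝ} (hε : 0 < ε) :
    ∃ w : ℝ → ℝ, MonotoneOn w (Icc 0 1) ∧ w 1 - w 0 ≤ ε ∧
      ∀ t ∈ N, ∀ C : ℝ, ∀ᶠ I in tagF t, C * (I.2 - I.1) ≤ w I.2 - w I.1 := by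
  have hO : ∀ k : ℕ, ∃ O : Set ℝ, N ⊆ O ∧ IsOpen O ∧
      volume O < ENNReal.ofReal (ε / 2 / 2 ^ k / (k + 1)) := fun k => by
    have h0 : volume N < ENNReal.ofReal (ε / 2 / 2 ^ k / (k + 1)) := by
      rw [hN]; exact ENNReal.ofReal_pos.2 (by positivity)
    obtain ⟨O, h1, h2, h3⟩ := N.exists_isOpen_lt_of_lt _ h0
    exact ⟨O, h1, h2, h3⟩
  choose O hNO hOo hOv using hO
  set v : ℕ → ℝ → ℝ := fun k x => (k + 1) * volume.real (O k ∩ Icc 0 x) with hv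
  have hfin : ∀ k (s : Set ℝ), volume (O k ∩ s) ≠ ∞ := fun k s =>
    (measure_mono inter_subset_left |>.trans_lt ((hOv k).trans ENNReal.ofReal_lt_top)).ne
  have hmono : ∀ k, Monotone (v k) := fun k x y hxy => by
    refine mul_le_mul_of_nonneg_left (measureReal_mono
      (inter_subset_inter_right _ (Icc_subset_Icc_right hxy)) (hfin k _)) (by positivity)
  obtain ⟨w, hw, hwε, hwv⟩ := exists_monotoneOn_tsum (v := v) (ε := ε)
    (fun k => (hmono k).monotoneOn _) fun k => by
      have h1 : volume.real (O k ∩ Icc 0 1) ≤ ε / 2 / 2 ^ k / (k + 1) :=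
        ENNReal.toReal_le_of_le_ofReal (by positivity)
          ((measure_mono inter_subset_left).trans (hOv k).le)
      have h2 : 0 ≤ v k 0 := by positivity
      have h3 : v k 1 ≤ ε / 2 / 2 ^ k := by
        rw [le_div_iff₀ (by positivity)] at h1
        simp only [hv]; linarith
      linarith
  refine ⟨w, hw, hwε, fun t ht C => ?_⟩
  obtain ⟨k, hk⟩ := exists_nat_ge C
  filter_upwards [eventually_tagF_subset ((hOo k).mem_nhds (hNO k ht)), eventually_tagF_mem t]
    with I hI hm
  have hxy : I.1 ≤ I.2 := hm.2.1.trans hm.2.2.1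
  refine le_trans ?_ (hwv k I.1 I.2 hm.1 hxy hm.2.2.2)
  have h1 : O k ∩ Icc 0 I.2 ⊇ O k ∩ Icc 0 I.1 ∪ Ioc I.1 I.2 := by
    refine union_subset (inter_subset_inter_right _ (Icc_subset_Icc_right hxy)) fun z hz =>
      ⟨hI ⟨hz.1.le, hz.2⟩, hm.1.trans hz.1.le, hz.2⟩
  have h2 : volume.real (O k ∩ Icc 0 I.1) + (I.2 - I.1) ≤ volume.real (O k ∩ Icc 0 I.2) := by
    refine le_trans (le_of_eq ?_) (measureReal_mono h1 (hfin k _))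
    rw [measureReal_union _ measurableSet_Ioc (hfin k _) (by simp)]
    · rw [Real.volume_real_Ioc_of_le hxy]
    · rw [Set.disjoint_left]
      rintro z ⟨-, hz⟩ hz'
      exact absurd hz'.1 (not_lt.2 hz.2)
  have h3 : v k I.2 - v k I.1 ≥ (k + 1) * (I.2 - I.1) := by
    simp only [hv, ← mul_sub]
    exact mul_le_mul_of_nonneg_left (by linarith) (by positivity)
  have h4 : C * (I.2 - I.1) ≤ (k + 1) * (I.2 - I.1) :=
    mul_le_mul_of_nonneg_right (by linarith) (by linarith)
  linarith

namespace VH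

variable {g P : ℝ → Y}

theorem clm {Z : Type*} [NormedAddCommGroup Z] [NormedSpace ℝ Z] (h : VH g P) (L : Y →L[ℝ] Z) :
    VH (fun t => L (g t)) fun t => L (P t) := by
  intro ε hε
  obtain ⟨v, hv, hvε, hvI⟩ := h (ε / (‖L‖ + 1)) (by positivity)
  refine ⟨fun x => (‖L‖ + 1) * v x, fun x hx y hy hxy =>
    mul_le_mul_of_nonneg_left (hv hx hy hxy) (by positivity), ?_, fun t ht => ?_⟩
  · rw [le_div_iff₀ (by positivity)] at hvε
    linarith
  · filter_upwards [hvI t ht] with I hI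
    rw [← map_sub, ← map_smul, ← map_sub, ← mul_sub]
    exact (L.le_opNorm _).trans (mul_le_mul (by linarith) hI (norm_nonneg _) (by positivity))

theorem continuousOn (h : VH g P) : ContinuousOn P (Icc 0 1) := by
  rw [Metric.continuousOn_iff]
  intro t ht ε hε
  obtain ⟨v, hv, hvε, hvI⟩ := h (ε / 3) (by positivity)
  have h01 : (0 : ℝ) ∈ Icc (0 : ℝ) 1 := ⟨le_rfl, zero_le_one⟩
  have h11 : (1 : ℝ) ∈ Icc (0 : ℝ) 1 := ⟨zero_le_one, le_rfl⟩
  have hvl : ∀ x ∈ Icc (0 : ℝ) 1, ∀ y ∈ Icc (0 : ℝ) 1, v y - v x ≤ ε / 3 := fun x hx y hy => by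
    have := hv h01 hx hx.1
    have := hv hy h11 hy.2
    linarith
  have h2 : ∀ᶠ x in 𝓝 t, ‖(x - t) • g t‖ < ε / 3 := by
    have : ContinuousAt (fun x : ℝ => ‖(x - t) • g t‖) t := by fun_prop
    exact this.eventually_lt_const (by simpa using hε)
  obtain ⟨r, hr, hb⟩ := Metric.eventually_nhds_iff.1
    ((eventually_nhds_of_tagF ht (hvI t ht)).and h2)
  refine ⟨r, hr, fun s hs hst => ?_⟩
  obtain ⟨h3, h4⟩ := hb hst
  rw [dist_eq_norm]
  rcases le_total s t with hle | hle
  · have h5 := ((h3 hs).1 hle).trans (hvl s hs t ht)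
    have h6 : P s - P t = -(P t - P s - (t - s) • g t) + (s - t) • g t := by module
    rw [h6]
    refine (norm_add_le _ _).trans_lt ?_
    rw [norm_neg]
    simp only at h5
    linarith
  · have h5 := ((h3 hs).2 hle).trans (hvl t ht s hs)
    have h6 : P s - P t = (P s - P t - (s - t) • g t) + (s - t) • g t := by module
    rw [h6]
    refine (norm_add_le _ _).trans_lt ?_
    simp only at h5
    linarith

theorem ae_hasDerivAt (h : VH g P) : ∀ᵐ t, t ∈ Ioo (0 : ℝ) 1 → HasDerivAt P (g t) t := by
  have h1 : ∀ k : ℕ, ∃ v : ℝ → ℝ, MonotoneOn v (Icc 0 1) ∧ v 1 - v 0 ≤ 1 / 2 / 2 ^ k ∧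
      ∀ t ∈ Icc (0 : ℝ) 1, ∀ᶠ I in tagF t,
        2 ^ k * ‖P I.2 - P I.1 - (I.2 - I.1) • g t‖ ≤ v I.2 - v I.1 := fun k => by
    obtain ⟨v, hv, hvε, hvI⟩ := h (1 / 2 / 2 ^ k / 2 ^ k) (by positivity)
    refine ⟨fun x => 2 ^ k * v x, fun x hx y hy hxy =>
      mul_le_mul_of_nonneg_left (hv hx hy hxy) (by positivity), ?_, fun t ht => ?_⟩
    · rw [le_div_iff₀ (by positivity)] at hvε
      linarith
    · filter_upwards [hvI t ht] with I hI
      rw [← mul_sub]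
      exact mul_le_mul_of_nonneg_left hI (by positivity)
  choose v hv hvk hvI using h1
  obtain ⟨w, hw, -, hwv⟩ := exists_monotoneOn_tsum hv hvk
  filter_upwards [hw.ae_differentiableWithinAt_of_mem] with t hdiff ht
  have htI : t ∈ Icc (0 : ℝ) 1 := Ioo_subset_Icc_self ht
  have hnb : Icc (0 : ℝ) 1 ∈ 𝓝 t := Icc_mem_nhds ht.1 ht.2
  have hd := ((hdiff htI).differentiableAt hnb).hasDerivAt
  set L := deriv w t
  rw [hasDerivAt_iff_isLittleO, Asymptotics.isLittleO_iff]
  intro c hc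
  obtain ⟨k, hk⟩ := exists_pow_lt_of_lt_one (show 0 < c / (|L| + 1) by positivity)
    (show (1 / 2 : ℝ) < 1 by norm_num)
  have hk' : |L| + 1 ≤ 2 ^ k * c := by
    rw [one_div, inv_pow, lt_div_iff₀ (by positivity), inv_mul_lt_iff₀ (by positivity)] at hk
    exact hk.le
  filter_upwards [hnb, eventually_nhds_of_tagF htI (hvI k t htI),
    (hasDerivAt_iff_isLittleO.1 hd).def one_pos] with x hx h2 h3
  have h4 : |w x - w t| ≤ (|L| + 1) * |x - t| := by
    have : w x - w t = (w x - w t - (x - t) • L) + (x - t) • L := by ring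
    rw [this]
    refine (abs_add_le _ _).trans ?_
    rw [smul_eq_mul, abs_mul]
    simp only [Real.norm_eq_abs, smul_eq_mul, one_mul] at h3
    linarith
  have h5 : 2 ^ k * ‖P x - P t - (x - t) • g t‖ ≤ |w x - w t| := by
    rcases le_total x t with hle | hle
    · have h6 : P x - P t - (x - t) • g t = -(P t - P x - (t - x) • g t) := by module
      rw [h6, norm_neg, abs_sub_comm]
      exact ((h2 hx).1 hle).trans ((hwv k x t hx.1 hle htI.2).trans (le_abs_self _))
    · exact ((h2 hx).2 hle).trans ((hwv k t x htI.1 hle hx.2).trans (le_abs_self _))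
  have h7 : (|L| + 1) * |x - t| ≤ 2 ^ k * c * |x - t| :=
    mul_le_mul_of_nonneg_right hk' (abs_nonneg _)
  have h8 : 2 ^ k * ‖P x - P t - (x - t) • g t‖ ≤ 2 ^ k * (c * |x - t|) := by linarith
  exact le_of_mul_le_mul_left h8 (by positivity)

theorem of_ae_hasDerivAt {Z : Type*} [NormedAddCommGroup Z] [NormedSpace ℝ Z] {G Q : ℝ → Z}
    (hQ : VH G Q) (hPQ : ∀ a b, 0 ≤ a → a ≤ b → b ≤ 1 → ‖P b - P a‖ ≤ ‖Q b - Q a‖)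
    (hd : ∀ᵐ t, t ∈ Ioo (0 : ℝ) 1 → HasDerivAt P (g t) t) : VH g P := by
  intro ε hε
  obtain ⟨v, hv, hvε, hvI⟩ := hQ (ε / 3) (by positivity)
  set N : Set ℝ := {t | ¬ (t ∈ Ioo (0 : ℝ) 1 → HasDerivAt P (g t) t)} ∪ {0, 1} with hN
  have hN0 : volume N = 0 := measure_union_null (ae_iff.1 hd) ((toFinite _).measure_zero _)
  obtain ⟨w, hw, hwε, hwI⟩ := exists_monotoneOn_of_null hN0 (show 0 < ε / 3 by positivity)
  refine ⟨fun x => v x + w x + ε / 3 * x, fun x hx y hy hxy => ?_, by linarith, fun t ht => ?_⟩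
  · have := hv hx hy hxy
    have := hw hx hy hxy
    have := mul_le_mul_of_nonneg_left hxy (show 0 ≤ ε / 3 by positivity)
    simp only
    linarith
  have hmono : ∀ᶠ I in tagF t, v I.1 ≤ v I.2 ∧ w I.1 ≤ w I.2 ∧ 0 ≤ ε / 3 * (I.2 - I.1) := by
    filter_upwards [eventually_tagF_mem t] with I hm
    have hxy : I.1 ≤ I.2 := hm.2.1.trans hm.2.2.1
    have h1 : I.1 ∈ Icc (0 : ℝ) 1 := ⟨hm.1, hxy.trans hm.2.2.2⟩
    have h2 : I.2 ∈ Icc (0 : ℝ) 1 := ⟨hm.1.trans hxy, hm.2.2.2⟩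
    exact ⟨hv h1 h2 hxy, hw h1 h2 hxy, mul_nonneg (by positivity) (by linarith)⟩
  by_cases htN : t ∈ N
  · filter_upwards [hmono, hvI t ht, hwI t htN (‖g t‖ + ‖G t‖), eventually_tagF_mem t]
      with I h1 h2 h3 hm
    have hxy : I.1 ≤ I.2 := hm.2.1.trans hm.2.2.1
    have h4 : ‖Q I.2 - Q I.1‖ ≤ (v I.2 - v I.1) + (I.2 - I.1) * ‖G t‖ := by
      have : Q I.2 - Q I.1 = (Q I.2 - Q I.1 - (I.2 - I.1) • G t) + (I.2 - I.1) • G t := by module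
      rw [this]
      refine (norm_add_le _ _).trans ?_
      rw [norm_smul, Real.norm_of_nonneg (sub_nonneg.2 hxy)]
      linarith
    have h5 := hPQ _ _ hm.1 hxy hm.2.2.2
    have h6 : ‖P I.2 - P I.1 - (I.2 - I.1) • g t‖ ≤ ‖P I.2 - P I.1‖ + (I.2 - I.1) * ‖g t‖ := by
      refine (norm_sub_le _ _).trans ?_
      rw [norm_smul, Real.norm_of_nonneg (sub_nonneg.2 hxy)]
    linarith [h1.2.2]
  · simp only [hN, mem_union, mem_ofPred_eq, not_or, not_not, mem_insert_iff,
      mem_singleton_iff] at htN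
    have htI : t ∈ Ioo (0 : ℝ) 1 :=
      ⟨lt_of_le_of_ne ht.1 (Ne.symm htN.2.1), lt_of_le_of_ne ht.2 htN.2.2⟩
    filter_upwards [hmono, straddle (htN.1 htI) (show 0 < ε / 3 by positivity)]
      with I h1 h2
    linarith

end VH

theorem exists_monotoneOn_integral_of_null {k : ℝ → ℝ} (hk : IntegrableOn k (Icc 0 1)) {N : Set ℝ}
    (hN : volume N = 0) {ε : ℝ} (hε : 0 < ε) :
    ∃ w : ℝ → ℝ, MonotoneOn w (Icc 0 1) ∧ w 1 - w 0 ≤ ε ∧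
      ∀ t ∈ N, ∀ᶠ I in tagF t, |∫ x in I.1..I.2, k x| ≤ w I.2 - w I.1 := by
  set κ := (Icc (0 : ℝ) 1).indicator k with hκ
  have hκi : Integrable κ := hk.integrable_indicator measurableSet_Icc
  obtain ⟨δ, hδ, hδs⟩ := exists_pos_setLIntegral_lt_of_measure_lt
    (μ := volume) (f := fun x => ‖κ x‖ₑ) hκi.2.ne (ENNReal.ofReal_pos.2 hε).ne'
  obtain ⟨O, hNO, hOo, hOv⟩ := N.exists_isOpen_lt_of_lt δ (by rwa [hN])
  set κO := O.indicator fun x => |κ x| with hκO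
  have hOi : Integrable κO := hκi.abs.indicator hOo.measurableSet
  have hpos : ∀ x, 0 ≤ κO x := fun x => indicator_nonneg (fun _ _ => abs_nonneg _) x
  have hsub : ∀ x y : ℝ, (∫ z in 0..y, κO z) - ∫ z in 0..x, κO z = ∫ z in x..y, κO z := fun x y =>
    intervalIntegral.integral_interval_sub_left hOi.intervalIntegrable hOi.intervalIntegrable
  refine ⟨fun x => ∫ z in 0..x, κO z, fun x _ y _ hxy => ?_, ?_, fun t ht => ?_⟩
  · have := intervalIntegral.integral_nonneg (μ := volume) (f := κO) hxy fun u _ => hpos u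
    rw [← hsub] at this
    simp only
    linarith
  · simp only [hsub]
    rw [intervalIntegral.integral_of_le zero_le_one]
    calc _ ≤ ∫ z, κO z := setIntegral_le_integral hOi (ae_of_all _ hpos)
      _ = ∫ z in O, |κ z| := integral_indicator hOo.measurableSet
      _ = (∫⁻ z in O, ‖κ z‖ₑ).toReal := by
        simp only [← Real.norm_eq_abs]
        exact integral_norm_eq_lintegral_enorm hκi.1.restrict
      _ ≤ ε := ENNReal.toReal_le_of_le_ofReal hε.le (hδs O hOv).le
  · filter_upwards [eventually_tagF_subset (hOo.mem_nhds (hNO ht)), eventually_tagF_mem t]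
      with I hI hm
    have hxy : I.1 ≤ I.2 := hm.2.1.trans hm.2.2.1
    simp only [hsub]
    refine (intervalIntegral.abs_integral_le_integral_abs hxy).trans (le_of_eq ?_)
    refine intervalIntegral.integral_congr fun z hz => ?_
    rw [uIcc_of_le hxy] at hz
    have hz1 : z ∈ Icc (0 : ℝ) 1 := ⟨hm.1.trans hz.1, hz.2.trans hm.2.2.2⟩
    simp [hκO, hκ, hI hz, hz1]

namespace VH

/-- Comparison of a scalar Henstock integral with a Lebesgue integral. -/
theorem setIntegral_le {h H k : ℝ → ℝ} (hH : VH h H) (hk : IntegrableOn k (Icc 0 1))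
    (hkh : ∀ᵐ t, t ∈ Icc (0 : ℝ) 1 → k t ≤ h t) : ∫ t in Icc (0 : ℝ) 1, k t ≤ H 1 - H 0 := by
  have hki : IntervalIntegrable k volume 0 1 :=
    (intervalIntegrable_iff_integrableOn_Icc_of_le zero_le_one).2 hk
  set K : ℝ → ℝ := fun x => ∫ z in 0..x, k z with hK
  have hKd : ∀ᵐ t, t ∈ Ioo (0 : ℝ) 1 → HasDerivAt K (k t) t := by
    filter_upwards [hki.ae_hasDerivAt_integral] with t ht htI
    refine ht ?_ 0 left_mem_uIcc
    rw [uIcc_of_le zero_le_one]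
    exact Ioo_subset_Icc_self htI
  have hKsub : ∀ x y, 0 ≤ x → x ≤ y → y ≤ 1 → K y - K x = ∫ z in x..y, k z := by
    intro x y h0 hxy h1
    have hi : ∀ z, 0 ≤ z → z ≤ 1 → IntervalIntegrable k volume 0 z := fun z hz0 hz1 =>
      hki.mono_set (by rw [uIcc_of_le hz0, uIcc_of_le zero_le_one]; exact Icc_subset_Icc_right hz1)
    exact intervalIntegral.integral_interval_sub_left (hi y (h0.trans hxy) h1)
      (hi x h0 (hxy.trans h1))
  have hK01 : K 1 - K 0 = ∫ t in Icc (0 : ℝ) 1, k t := by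
    rw [hKsub 0 1 le_rfl zero_le_one le_rfl, intervalIntegral.integral_of_le zero_le_one,
      integral_Icc_eq_integral_Ioc]
  rw [← hK01]
  refine le_of_forall_pos_le_add fun ε' hε' => ?_
  obtain ⟨ε, hε, hεε⟩ : ∃ ε > 0, 5 * ε = ε' := ⟨ε' / 5, by positivity, by ring⟩
  set N : Set ℝ := {t | ¬ (t ∈ Ioo (0 : ℝ) 1 → HasDerivAt H (h t) t ∧ HasDerivAt K (k t) t ∧
    k t ≤ h t)} ∪ {0, 1} with hN
  have hN0 : volume N = 0 := by
    refine measure_union_null (ae_iff.1 ?_) ((toFinite _).measure_zero _)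
    filter_upwards [hH.ae_hasDerivAt, hKd, hkh] with t h1 h2 h3 ht
    exact ⟨h1 ht, h2 ht, h3 (Ioo_subset_Icc_self ht)⟩
  obtain ⟨v, hv, hvε, hvI⟩ := hH ε hε
  obtain ⟨w, hw, hwε, hwI⟩ := exists_monotoneOn_of_null hN0 hε
  obtain ⟨u, hu, huε, huI⟩ := exists_monotoneOn_integral_of_null hk hN0 hε
  have := le_of_locally_le (G := fun x => H x - K x + v x + w x + u x + 2 * ε * x) fun t ht => by
    have hmono : ∀ᶠ I in tagF t, v I.1 ≤ v I.2 ∧ w I.1 ≤ w I.2 ∧ u I.1 ≤ u I.2 ∧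
        0 ≤ ε * (I.2 - I.1) := by
      filter_upwards [eventually_tagF_mem t] with I hm
      have hxy : I.1 ≤ I.2 := hm.2.1.trans hm.2.2.1
      have h1 : I.1 ∈ Icc (0 : ℝ) 1 := ⟨hm.1, hxy.trans hm.2.2.2⟩
      have h2 : I.2 ∈ Icc (0 : ℝ) 1 := ⟨hm.1.trans hxy, hm.2.2.2⟩
      exact ⟨hv h1 h2 hxy, hw h1 h2 hxy, hu h1 h2 hxy, mul_nonneg (by positivity) (by linarith)⟩
    by_cases htN : t ∈ N
    · filter_upwards [hmono, hvI t ht, hwI t htN |h t|, huI t htN, eventually_tagF_mem t]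
        with I h1 h2 h3 h4 hm
      have hxy : I.1 ≤ I.2 := hm.2.1.trans hm.2.2.1
      rw [← hKsub _ _ hm.1 hxy hm.2.2.2] at h4
      rw [Real.norm_eq_abs, smul_eq_mul] at h2
      have h5 : (I.2 - I.1) * -|h t| ≤ (I.2 - I.1) * h t :=
        mul_le_mul_of_nonneg_left (neg_abs_le _) (by linarith)
      linarith [(abs_le.1 h2).1, (abs_le.1 h4).2]
    · simp only [hN, mem_union, mem_ofPred_eq, not_or, not_not, mem_insert_iff,
        mem_singleton_iff] at htN
      have htI : t ∈ Ioo (0 : ℝ) 1 :=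
        ⟨lt_of_le_of_ne ht.1 (Ne.symm htN.2.1), lt_of_le_of_ne ht.2 htN.2.2⟩
      obtain ⟨hd1, hd2, hle⟩ := htN.1 htI
      filter_upwards [hmono, straddle hd1 hε, straddle hd2 hε, eventually_tagF_mem t]
        with I h1 h2 h3 hm
      have hxy : I.1 ≤ I.2 := hm.2.1.trans hm.2.2.1
      rw [Real.norm_eq_abs, smul_eq_mul] at h2 h3
      have h5 : (I.2 - I.1) * k t ≤ (I.2 - I.1) * h t :=
        mul_le_mul_of_nonneg_left hle (by linarith)
      linarith [(abs_le.1 h2).1, (abs_le.1 h3).2]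
  linarith

theorem setIntegral_eq {h H : ℝ → ℝ} (hH : VH h H) (hi : IntegrableOn h (Icc 0 1)) :
    ∫ t in Icc (0 : ℝ) 1, h t = H 1 - H 0 := by
  refine le_antisymm (hH.setIntegral_le hi (ae_of_all _ fun _ _ => le_rfl)) ?_
  have h1 := (hH.clm (-ContinuousLinearMap.id ℝ ℝ)).setIntegral_le (k := fun t => -h t) hi.neg
    (ae_of_all _ fun _ _ => by simp)
  rw [integral_neg] at h1
  simp only [neg_apply, ContinuousLinearMap.id_apply] at h1
  linarith

theorem aestronglyMeasurable {g P : ℝ → Y} (h : VH g P) :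
    AEStronglyMeasurable g (volume.restrict (Icc 0 1)) := by
  set Q : ℝ → Y := IccExtend zero_le_one ((Icc (0 : ℝ) 1).domRestrict P) with hQ
  have hQc : Continuous Q := (continuousOn_iff_continuous_domRestrict.1 h.continuousOn).Icc_extend'
  have hQP : ∀ x ∈ Icc (0 : ℝ) 1, Q x = P x := fun x hx => by
    rw [hQ, IccExtend_of_mem _ _ hx]
    rfl
  refine aestronglyMeasurable_of_tendsto_ae atTop
    (f := fun (n : ℕ) t => (1 / ((n : ℝ) + 1))⁻¹ • (Q (t + 1 / ((n : ℝ) + 1)) - Q t))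
    (fun n => ?_) ?_
  · exact Continuous.aestronglyMeasurable (by fun_prop)
  · rw [← restrict_Ioo_eq_restrict_Icc, ae_restrict_iff' measurableSet_Ioo]
    filter_upwards [h.ae_hasDerivAt] with t ht htI
    have hd : HasDerivAt Q (g t) t := (ht htI).congr_of_eventuallyEq <| by
      filter_upwards [Icc_mem_nhds htI.1 htI.2] with x hx using hQP x hx
    refine hd.tendsto_slope_zero.comp (tendsto_nhdsWithin_iff.2
      ⟨tendsto_one_div_add_atTop_nhds_zero_nat, Eventually.of_forall fun n => ?_⟩)
    have : (0 : ℝ) < 1 / ((n : ℝ) + 1) := by positivity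
    exact this.ne'

theorem integrableOn_of_le {h H k : ℝ → ℝ} (hH : VH h H) (hk : IntegrableOn k (Icc 0 1))
    (hkh : ∀ᵐ t, t ∈ Icc (0 : ℝ) 1 → k t ≤ h t) : IntegrableOn h (Icc 0 1) := by
  set u : ℝ → ℝ := fun t => h t - k t with hu
  have hum : AEStronglyMeasurable u (volume.restrict (Icc 0 1)) :=
    hH.aestronglyMeasurable.sub hk.1
  have hu0 : ∀ᵐ t ∂volume.restrict (Icc (0 : ℝ) 1), 0 ≤ u t := by
    rw [ae_restrict_iff' measurableSet_Icc]
    filter_upwards [hkh] with t ht htI using sub_nonneg.2 (ht htI)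
  suffices hui : IntegrableOn u (Icc 0 1) by
    refine (hui.add hk).congr (ae_of_all _ fun t => ?_)
    simp [hu]
  set C := H 1 - H 0 - ∫ t in Icc (0 : ℝ) 1, k t
  have hbd : ∀ n : ℕ, ∫⁻ t in Icc (0 : ℝ) 1, ENNReal.ofReal (min (u t) n) ≤ ENNReal.ofReal C := by
    intro n
    have hmi : IntegrableOn (fun t => min (u t) n) (Icc 0 1) := by
      refine (integrable_const (n : ℝ)).mono' (hum.inf aestronglyMeasurable_const) ?_
      filter_upwards [hu0] with t ht
      rw [Real.norm_of_nonneg (le_min ht (by positivity))]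
      exact min_le_right _ _
    rw [← ofReal_integral_eq_lintegral_ofReal hmi
      (by filter_upwards [hu0] with t ht using le_min ht (by positivity))]
    refine ENNReal.ofReal_le_ofReal ?_
    have h1 := hH.setIntegral_le (hmi.add hk) (ae_of_all _ fun t _ => by
      have := min_le_left (u t) n
      simp only [Pi.add_apply, hu] at this ⊢
      linarith)
    simp only [Pi.add_apply] at h1
    rw [integral_add hmi hk] at h1
    simp only [C]
    linarith
  refine ⟨hum, ?_⟩
  rw [hasFiniteIntegral_iff_ofReal hu0]
  refine lt_of_le_of_lt ?_ (ENNReal.ofReal_lt_top (r := C))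
  calc ∫⁻ t in Icc (0 : ℝ) 1, ENNReal.ofReal (u t)
      ≤ ∫⁻ t in Icc (0 : ℝ) 1, liminf (fun n : ℕ => ENNReal.ofReal (min (u t) n)) atTop := by
        refine lintegral_mono fun t => le_of_eq ?_
        refine (Tendsto.liminf_eq (tendsto_const_nhds.congr' ?_)).symm
        obtain ⟨m, hm⟩ := exists_nat_ge (u t)
        filter_upwards [eventually_ge_atTop m] with n hn
        rw [min_eq_left (hm.trans (by exact_mod_cast hn))]
    _ ≤ liminf (fun n : ℕ => ∫⁻ t in Icc (0 : ℝ) 1, ENNReal.ofReal (min (u t) n)) atTop :=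
        lintegral_liminf_le' fun n =>
          (hum.aemeasurable.min aemeasurable_const).ennreal_ofReal
    _ ≤ ENNReal.ofReal C :=
        (liminf_le_liminf (Eventually.of_forall hbd)).trans (by simp)

end VH

/-! ### Uniform integrability and McShane integrals -/

/-- Uniform integrability over `[0,1]` of a family of real functions. -/
def UI {ι : Type*} (u : ι → ℝ → ℝ) : Prop :=
  (∀ b, IntegrableOn (u b) (Icc 0 1)) ∧ ∀ ε > 0, ∃ η > 0, ∀ E ⊆ Icc (0 : ℝ) 1,
    MeasurableSet E → volume E ≤ ENNReal.ofReal η → ∀ b, ∫ t in E, |u b t| ≤ ε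

theorem intervalIntegrable_of_mem {E : Type*} [NormedAddCommGroup E] {u : ℝ → E}
    (hu : IntegrableOn u (Icc 0 1)) {a b : ℝ} (ha : a ∈ Icc (0 : ℝ) 1) (hb : b ∈ Icc (0 : ℝ) 1) :
    IntervalIntegrable u volume a b :=
  (hu.mono_set (uIcc_subset_Icc ha hb)).intervalIntegrable

theorem TP.sum_intervalIntegral {n : ℕ} (P : TP n) {u : ℝ → ℝ} (hu : IntegrableOn u (Icc 0 1)) :
    ∑ i : Fin n, ∫ t in P.pt i.castSucc..P.pt i.succ, u t = ∫ t in Icc (0 : ℝ) 1, u t := by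
  have h0 : (0 : ℝ) ∈ Icc (0 : ℝ) 1 := ⟨le_rfl, zero_le_one⟩
  have hm : ∀ i, P.pt i ∈ Icc (0 : ℝ) 1 := fun i => ⟨P.pt_nonneg i, P.pt_le_one i⟩
  have := P.sum_sub fun x => ∫ t in (0 : ℝ)..x, u t
  rw [intervalIntegral.integral_same, sub_zero, intervalIntegral.integral_of_le zero_le_one,
    ← integral_Icc_eq_integral_Ioc] at this
  rw [← this]
  exact Finset.sum_congr rfl fun i _ => (intervalIntegral.integral_interval_sub_left
    (intervalIntegrable_of_mem hu h0 (hm _)) (intervalIntegrable_of_mem hu h0 (hm _))).symm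

theorem TP.abs_integral_sub_sum_le {n : ℕ} (P : TP n) {u F : ℝ → ℝ}
    (hu : IntegrableOn u (Icc 0 1)) (hF : IntegrableOn F (Icc 0 1)) {c : Fin n → ℝ}
    (h : ∀ i, ∀ᵐ s, s ∈ P.ivl i → |u s - c i| ≤ F s) :
    |(∫ t in Icc (0 : ℝ) 1, u t) - ∑ i, P.len i * c i| ≤ ∫ t in Icc (0 : ℝ) 1, F t := by
  have hm : ∀ i, P.pt i ∈ Icc (0 : ℝ) 1 := fun i => ⟨P.pt_nonneg i, P.pt_le_one i⟩
  rw [← P.sum_intervalIntegral hu, ← P.sum_intervalIntegral hF, ← Finset.sum_sub_distrib]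
  refine (Finset.abs_sum_le_sum_abs _ _).trans (Finset.sum_le_sum fun i _ => ?_)
  have hui := intervalIntegrable_of_mem hu (hm i.castSucc) (hm i.succ)
  have h1 : (∫ t in P.pt i.castSucc..P.pt i.succ, u t) - P.len i * c i =
      ∫ t in P.pt i.castSucc..P.pt i.succ, (u t - c i) := by
    rw [intervalIntegral.integral_sub hui intervalIntegrable_const,
      intervalIntegral.integral_const, TP.len, smul_eq_mul]
  rw [h1, ← Real.norm_eq_abs]
  refine intervalIntegral.norm_integral_le_of_norm_le (P.pt_le i) ?_
    (intervalIntegrable_of_mem hF (hm _) (hm _))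
  filter_upwards [h i] with s hs hsI
  exact hs (Ioc_subset_Icc_self hsI)

/-- A strongly measurable function whose scalar compositions with a norming family of functionals
are uniformly integrable is McShane integrable as soon as it has a weak integral. -/
theorem UI.exists_gauge {ι : Type*} {e : ι → Y →L[ℝ] ℝ} (he : ∀ b, ‖e b‖ ≤ 1)
    (hnorm : ∀ y C, (∀ b, |e b y| ≤ C) → ‖y‖ ≤ C) {g : ℝ → Y}
    (hg : AEStronglyMeasurable g (volume.restrict (Icc 0 1)))
    (hui : UI fun b t => e b (g t)) {w : Y}
    (hw : ∀ b, e b w = ∫ t in Icc (0 : ℝ) 1, e b (g t)) {ε : ℝ} (hε : 0 < ε) :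
    ∃ δ, IsGauge δ ∧ ∀ (n : ℕ) (P : TP n), P.IsFine δ → ‖w - fSum P g‖ ≤ 4 * ε := by
  obtain ⟨g', hg', hgg⟩ := hg
  rw [EventuallyEq, ae_restrict_iff' measurableSet_Icc] at hgg
  have hele : ∀ b y, |e b y| ≤ ‖y‖ := fun b y =>
    ((e b).le_opNorm y).trans (mul_le_of_le_one_left (norm_nonneg y) (he b))
  obtain ⟨c, hcc, hc⟩ := hg'.isSeparable_range
  have hcne : c.Nonempty := by
    rcases c.eq_empty_or_nonempty with rfl | h
    · simpa using hc (mem_range_self 0)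
    · exact h
  obtain ⟨y, rfl⟩ := hcc.exists_eq_range hcne
  have hy : ∀ t, ∃ n, ‖g' t - y n‖ < ε := fun t => by
    obtain ⟨_, ⟨n, rfl⟩, hn⟩ := Metric.mem_closure_iff.1 (hc (mem_range_self t)) ε hε
    exact ⟨n, by rwa [← dist_eq_norm]⟩
  obtain ⟨η, hη, hηE⟩ := hui.2 ε hε
  obtain ⟨N, hNsub, hNm, hN0⟩ := exists_measurable_superset_of_null (ae_iff.1 hgg)
  set E : ℕ ⊕ ℕ → Set ℝ := Sum.elim (fun n => {t | ‖g' t - y n‖ < ε} ∩ Icc 0 1) fun _ => N with hE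
  set C : ℕ ⊕ ℕ → ℝ := Sum.elim (fun n => ‖y n‖ + ε) fun k => (k : ℝ) with hC
  have hC0 : ∀ i, 0 ≤ C i := by
    rintro (n | k)
    · simp only [hC, Sum.elim_inl]; positivity
    · simp only [hC, Sum.elim_inr]; positivity
  have hEm : ∀ i, MeasurableSet (E i) := by
    rintro (n | k)
    · exact (measurableSet_lt (hg'.sub stronglyMeasurable_const).norm.measurable
        measurable_const).inter measurableSet_Icc
    · exact hNm
  have hEfin : ∀ i, volume (E i) ≠ ∞ := by
    rintro (n | k)
    · exact ((measure_mono inter_subset_right).trans_lt (by simp)).ne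
    · simp [hE, hN0]
  obtain ⟨κ, hκ, hκs⟩ := ENNReal.exists_pos_sum_of_countable'
    (ENNReal.ofReal_pos.2 (lt_min hε hη)).ne' (ℕ ⊕ ℕ)
  have hU : ∀ i, ∃ U ⊇ E i, IsOpen U ∧ volume (U \ E i) < κ i / ENNReal.ofReal (C i + 1) :=
    fun i => by
      obtain ⟨U, h1, h2, -, h3⟩ := (hEm i).exists_isOpen_sdiff_lt (hEfin i)
        (ENNReal.div_pos (hκ i).ne' ENNReal.ofReal_ne_top).ne'
      exact ⟨U, h1, h2, h3⟩
  choose U hEU hUo hUv using hU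
  set Z : ℕ ⊕ ℕ → Set ℝ := fun i => U i \ E i with hZ
  have hZm : ∀ i, MeasurableSet (Z i) := fun i => (hUo i).measurableSet.diff (hEm i)
  have hZv : ∀ i, ENNReal.ofReal (C i + 1) * volume (Z i) ≤ κ i := fun i => by
    have h1 : ENNReal.ofReal (C i + 1) ≠ 0 := (ENNReal.ofReal_pos.2 (by linarith [hC0 i])).ne'
    have := (hUv i).le
    rwa [ENNReal.le_div_iff_mul_le (Or.inl h1) (Or.inl ENNReal.ofReal_ne_top), mul_comm] at this
  have hpiece : ∀ t ∈ Icc (0 : ℝ) 1, ∃ i, t ∈ U i ∧ ‖g t‖ ≤ C i ∧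
      ∀ s ∈ U i, s ∉ Z i → s ∉ N → ‖g t - g' s‖ ≤ 2 * ε := by
    intro t ht
    by_cases htN : t ∈ N
    · obtain ⟨k, hk⟩ := exists_nat_ge ‖g t‖
      exact ⟨.inr k, hEU _ htN, hk, fun s hs hsZ hsN => absurd ⟨hs, hsN⟩ hsZ⟩
    · have hgt : g t = g' t := by
        by_contra hne
        exact htN (hNsub fun h => hne (h ht))
      obtain ⟨n, hn⟩ := hy t
      refine ⟨.inl n, hEU _ ⟨hn, ht⟩, ?_, fun s hs hsZ _ => ?_⟩
      · have : g t = (g' t - y n) + y n := by rw [hgt]; abel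
        rw [this]
        refine (norm_add_le _ _).trans ?_
        simp only [hC, Sum.elim_inl]
        linarith
      · have hsE : s ∈ E (.inl n) := by
          by_contra hh
          exact hsZ ⟨hs, hh⟩
        have h1 : ‖g' s - y n‖ < ε := hsE.1
        have : g t - g' s = (g' t - y n) - (g' s - y n) := by rw [hgt]; abel
        rw [this]
        refine (norm_sub_le _ _).trans ?_
        linarith
  have hgauge : ∀ t ∈ Icc (0 : ℝ) 1, ∃ δ > 0, ∃ i, Ioo (t - δ) (t + δ) ⊆ U i ∧ ‖g t‖ ≤ C i ∧
      ∀ s ∈ U i, s ∉ Z i → s ∉ N → ‖g t - g' s‖ ≤ 2 * ε := fun t ht => by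
    obtain ⟨i, hi, h1, h2⟩ := hpiece t ht
    obtain ⟨δ, hδ, hs⟩ := (nhds_basis_Ioo_pos t).mem_iff.1 ((hUo i).mem_nhds hi)
    exact ⟨δ, hδ, i, hs, h1, h2⟩
  choose! δ hδ i hiU hiC hi using hgauge
  refine ⟨δ, hδ, fun n P hP => hnorm _ _ fun b => ?_⟩
  set F : ℝ → ℝ≥0∞ := fun s => ENNReal.ofReal (2 * ε) +
    ((∑' j, (Z j).indicator (fun _ => ENNReal.ofReal (C j + 1)) s) +
      (⋃ j, Z j).indicator (fun s => ‖e b (g s)‖ₑ) s) with hF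
  have hZun : MeasurableSet (⋃ j, Z j) := MeasurableSet.iUnion hZm
  have hm1 : Measurable fun s => ∑' j, (Z j).indicator (fun _ => ENNReal.ofReal (C j + 1)) s :=
    Measurable.tsum fun j => measurable_const.indicator (hZm j)
  have hm2 : AEMeasurable ((⋃ j, Z j).indicator fun s => ‖e b (g s)‖ₑ)
      (volume.restrict (Icc 0 1)) := (hui.1 b).1.enorm.indicator hZun
  have hFm : AEMeasurable F (volume.restrict (Icc 0 1)) :=
    aemeasurable_const.add (hm1.aemeasurable.add hm2)
  have hsum1 : ∫⁻ s in Icc (0 : ℝ) 1, ∑' j, (Z j).indicator (fun _ => ENNReal.ofReal (C j + 1)) s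
      ≤ ENNReal.ofReal ε := by
    rw [lintegral_tsum fun j => (measurable_const.indicator (hZm j)).aemeasurable]
    calc _ ≤ ∑' j, κ j := ENNReal.tsum_le_tsum fun j => by
          rw [lintegral_indicator_const (hZm j)]
          exact (mul_le_mul_right (Measure.restrict_apply_le _ _) _).trans (hZv j)
      _ ≤ ENNReal.ofReal ε := hκs.le.trans (ENNReal.ofReal_le_ofReal (min_le_left _ _))
  have hZvol : volume (⋃ j, Z j) ≤ ENNReal.ofReal η := by
    refine (measure_iUnion_le _).trans ?_
    refine (ENNReal.tsum_le_tsum fun j => ?_).trans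
      (hκs.le.trans (ENNReal.ofReal_le_ofReal (min_le_right _ _)))
    refine le_trans ?_ (hZv j)
    refine le_mul_of_one_le_left' ?_
    rw [← ENNReal.ofReal_one]
    exact ENNReal.ofReal_le_ofReal (by linarith [hC0 j])
  have hsum2 : ∫⁻ s in Icc (0 : ℝ) 1, (⋃ j, Z j).indicator (fun s => ‖e b (g s)‖ₑ) s ≤
      ENNReal.ofReal ε := by
    rw [lintegral_indicator hZun, Measure.restrict_restrict hZun]
    have h1 := hηE ((⋃ j, Z j) ∩ Icc 0 1) inter_subset_right (hZun.inter measurableSet_Icc)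
      ((measure_mono inter_subset_left).trans hZvol) b
    have h2 : IntegrableOn (fun t => e b (g t)) ((⋃ j, Z j) ∩ Icc 0 1) :=
      (hui.1 b).mono_set inter_subset_right
    rw [← ofReal_integral_norm_eq_lintegral_enorm h2]
    exact ENNReal.ofReal_le_ofReal h1
  have hFint : ∫⁻ s in Icc (0 : ℝ) 1, F s ≤ ENNReal.ofReal (4 * ε) := by
    simp only [hF]
    rw [lintegral_add_left measurable_const, lintegral_add_left hm1]
    have h1 : ∫⁻ _ in Icc (0 : ℝ) 1, ENNReal.ofReal (2 * ε) = ENNReal.ofReal (2 * ε) := by simp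
    rw [h1, show 4 * ε = 2 * ε + (ε + ε) by ring, ENNReal.ofReal_add (by positivity)
      (by positivity), ENNReal.ofReal_add hε.le hε.le]
    gcongr
  have hFne : ∫⁻ s in Icc (0 : ℝ) 1, F s ≠ ∞ := (hFint.trans_lt ENNReal.ofReal_lt_top).ne
  have hFfin := (ae_restrict_iff' measurableSet_Icc).1 (ae_lt_top' hFm hFne)
  have hmain := P.abs_integral_sub_sum_le (hui.1 b)
    (integrable_toReal_of_lintegral_ne_top hFm hFne) (c := fun j => e b (g (P.tag j))) fun j => by
      have hNae : ∀ᵐ s, s ∉ N := measure_eq_zero_iff_ae_notMem.1 hN0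
      filter_upwards [hgg, hNae, hFfin] with s hs hsN hsF hsI
      have hsIcc : s ∈ Icc (0 : ℝ) 1 :=
        ⟨(P.pt_nonneg _).trans hsI.1, hsI.2.trans (P.pt_le_one _)⟩
      have ht := P.tagMem j
      rw [← ENNReal.ofReal_le_iff_le_toReal (hsF hsIcc).ne]
      have hsU := hiU _ ht (hP j hsI)
      by_cases hsZ : s ∈ Z (i (P.tag j))
      · have h1 : ENNReal.ofReal (C (i (P.tag j)) + 1) ≤
            ∑' j, (Z j).indicator (fun _ => ENNReal.ofReal (C j + 1)) s := by
          have := ENNReal.le_tsum (f := fun j =>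
            (Z j).indicator (fun _ => ENNReal.ofReal (C j + 1)) s) (i (P.tag j))
          simpa [indicator_of_mem hsZ] using this
        have h2 : (⋃ j, Z j).indicator (fun s => ‖e b (g s)‖ₑ) s = ENNReal.ofReal |e b (g s)| := by
          rw [indicator_of_mem (mem_iUnion.2 ⟨_, hsZ⟩), Real.enorm_eq_ofReal_abs]
        have h3 : |e b (g s) - e b (g (P.tag j))| ≤ (C (i (P.tag j)) + 1) + |e b (g s)| := by
          have h4 := (hele b (g (P.tag j))).trans (hiC _ ht)
          have h5 := abs_sub (e b (g s)) (e b (g (P.tag j)))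
          linarith
        refine (ENNReal.ofReal_le_ofReal h3).trans ?_
        rw [ENNReal.ofReal_add (by linarith [hC0 (i (P.tag j))]) (abs_nonneg _), hF]
        simp only [h2]
        exact (add_le_add_left h1 _).trans le_add_self
      · have h1 := hi _ ht s hsU hsZ hsN
        rw [← hs hsIcc, norm_sub_rev] at h1
        have h2 := (hele b _).trans h1
        rw [map_sub] at h2
        exact (ENNReal.ofReal_le_ofReal h2).trans le_self_add
  have h1 : ∫ s in Icc (0 : ℝ) 1, (F s).toReal ≤ 4 * ε := by
    rw [integral_toReal hFm ((ae_restrict_iff' measurableSet_Icc).2 hFfin)]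
    exact ENNReal.toReal_le_of_le_ofReal (by positivity) hFint
  refine le_trans (le_of_eq ?_) (hmain.trans h1)
  rw [map_sub, hw, fSum, map_sum]
  simp only [map_smul, smul_eq_mul]

theorem FMcShaneIntegrable.exists_lintegral_le {g : ℝ → Y} (hg : FMcShaneIntegrable g) {ε : ℝ}
    (hε : 0 < ε) : ∃ η > 0, ∀ E ⊆ Icc (0 : ℝ) 1, MeasurableSet E →
      volume E ≤ ENNReal.ofReal η → ∀ e : Y →L[ℝ] ℝ, ‖e‖ ≤ 1 →
        ∫⁻ t in E, ENNReal.ofReal (e (g t)) ≤ ENNReal.ofReal (5 * ε) := by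
  obtain ⟨w, hw⟩ := hg
  obtain ⟨δ, hδ, hδw⟩ := hw ε hε
  obtain ⟨TI, hT⟩ := isCompact_Icc.elim_nhds_subcover' (s := Icc (0 : ℝ) 1)
    (fun t ht => Ioo (t - δ t) (t + δ t))
    fun t ht => Ioo_mem_nhds (by linarith [hδ t ht]) (by linarith [hδ t ht])
  obtain ⟨M, hM0, hM⟩ : ∃ M > 0, ∀ i ∈ TI, ‖g (i : ℝ)‖ ≤ M :=
    ⟨∑ i ∈ TI, ‖g i‖ + 1, by positivity, fun i hi =>
      (Finset.single_le_sum (f := fun i : Icc (0 : ℝ) 1 => ‖g i‖) (fun _ _ => norm_nonneg _)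
        hi).trans (by linarith)⟩
  refine ⟨ε / (2 * M), by positivity, fun E hEI hEm hEv e he => ?_⟩
  have hele : ∀ y, |e y| ≤ ‖y‖ := fun y =>
    (e.le_opNorm y).trans (mul_le_of_le_one_left (norm_nonneg y) he)
  obtain ⟨U, hEU, hUo, hUv⟩ := E.exists_isOpen_lt_of_lt (ENNReal.ofReal (ε / M))
    (hEv.trans_lt ((ENNReal.ofReal_lt_ofReal_iff (by positivity)).2 (by
      rw [div_lt_div_iff₀ (by positivity) hM0]; nlinarith [mul_pos hε hM0])))
  rw [← lintegral_indicator hEm, lintegral_eq_nnreal]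
  refine iSup₂_le fun φ hφ => ?_
  rw [← SimpleFunc.lintegral_eq_lintegral]
  simp only [SimpleFunc.map_apply]
  obtain ⟨C, hC⟩ := φ.exists_forall_le
  have hφ0 : ∀ x ∉ E, φ x = 0 := fun x hx => by simpa [hx] using hφ x
  have hφE : ∫⁻ x, φ x = ∫⁻ x in E, φ x :=
    (setLIntegral_eq_of_support_subset fun x hx => by
      by_contra hxE
      simp [hφ0 x hxE] at hx).symm
  have hφfin : ∫⁻ x, φ x ≠ ∞ := by
    rw [hφE]
    refine (lt_of_le_of_lt (lintegral_mono fun x => ENNReal.coe_le_coe.2 (hC x)) ?_).ne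
    rw [lintegral_const, Measure.restrict_apply_univ]
    exact ENNReal.mul_lt_top ENNReal.coe_lt_top (hEv.trans_lt ENNReal.ofReal_lt_top)
  obtain ⟨s, hsφ, hsu, hs⟩ := φ.exists_upperSemicontinuous_le_lintegral_le hφfin
    (ENNReal.ofReal_pos.2 hε).ne'
  have hsC : ∀ x, s x ≤ C := fun x => (hsφ x).trans (hC x)
  have hsm : Measurable s := hsu.measurable
  have hsi : IntegrableOn (fun x => (s x : ℝ)) (Icc 0 1) := by
    refine (integrable_const (C : ℝ)).mono' hsm.coe_nnreal_real.aestronglyMeasurable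
      (ae_of_all _ fun x => ?_)
    simpa using hsC x
  set u : ℝ → ℝ := fun x => s x - ε - U.indicator (fun _ => M) x with hu
  have hUi : IntegrableOn (U.indicator fun _ => M) (Icc 0 1) :=
    (integrable_const M).indicator hUo.measurableSet
  have hci : IntegrableOn (fun _ : ℝ => ε) (Icc 0 1) := integrable_const ε
  have hui : IntegrableOn u (Icc 0 1) := (hsi.sub hci).sub hUi
  set R : ℝ → ℝ → ℝ → Prop := fun x y t => t ∈ Icc (0 : ℝ) 1 ∧ t - δ t < x ∧ y < t + δ t with hR
  set F : ℝ → ℝ → ℝ → Y := fun x y t => (y - x) • g t with hF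
  have hbound : ∀ x y c, x ∈ Icc (0 : ℝ) 1 → y ∈ Icc (0 : ℝ) 1 → x ≤ y →
      (∀ z ∈ Icc x y, u z ≤ c) → ∫ z in x..y, u z ≤ (y - x) * c := by
    intro x y c hx hy hxy h
    have := intervalIntegral.integral_mono_on hxy (intervalIntegrable_of_mem hui hx hy)
      (intervalIntegrable_const (c := c)) h
    rwa [intervalIntegral.integral_const, smul_eq_mul] at this
  have hcous : ∃ S S' : Y, Att R F 0 1 S ∧ Att R F 0 1 S' ∧ ∫ z in (0 : ℝ)..1, u z ≤ e S - e S' := by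
    refine cousin (Q := fun x y => ∃ S S' : Y, Att R F x y S ∧ Att R F x y S' ∧
      ∫ z in x..y, u z ≤ e S - e S') zero_le_one ?_ fun t ht => ?_
    · rintro x y z h0 hxy hyz h1 ⟨S, S', hS, hS', h⟩ ⟨T, T', hT, hT', h'⟩
      refine ⟨_, _, hS.trans hT, hS'.trans hT', ?_⟩
      have hx : x ∈ Icc (0 : ℝ) 1 := ⟨h0, by linarith⟩
      have hy : y ∈ Icc (0 : ℝ) 1 := ⟨by linarith, by linarith⟩
      have hz : z ∈ Icc (0 : ℝ) 1 := ⟨by linarith, h1⟩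
      rw [← intervalIntegral.integral_add_adjacent_intervals (intervalIntegrable_of_mem hui hx hy)
        (intervalIntegrable_of_mem hui hy hz), map_add, map_add]
      linarith
    · have hlt : ∀ᶠ z in 𝓝 t, (s z : ℝ) < s t + ε := by
        have := hsu t (s t + ε.toNNReal) (lt_add_of_pos_right _ (Real.toNNReal_pos.2 hε))
        filter_upwards [this] with z hz
        have hz' : (s z : ℝ) < ((s t + ε.toNNReal : ℝ≥0) : ℝ) := NNReal.coe_lt_coe.2 hz
        rwa [NNReal.coe_add, Real.coe_toNNReal _ hε.le] at hz'
      have hδt := hδ t ht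
      have hIoo : Ioo (t - δ t) (t + δ t) ∈ 𝓝 t := Ioo_mem_nhds (by linarith) (by linarith)
      by_cases hst : s t ≠ 0
      · have htE : t ∈ E := by
          by_contra htE
          exact hst (le_antisymm ((hsφ t).trans (hφ0 t htE).le) zero_le)
        obtain ⟨i, hi, hti⟩ := mem_iUnion₂.1 (hT ht)
        obtain ⟨r, hr, hsub⟩ := (nhds_basis_Ioo_pos t).mem_iff.1 (inter_mem (inter_mem hlt hIoo)
          (inter_mem (hUo.mem_nhds (hEU htE)) (Ioo_mem_nhds hti.1 hti.2)))
        refine ⟨r, hr, fun x y h0 hx hy h1 hxr hyr => ?_⟩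
        have hxy := hx.trans hy
        have hin : ∀ z ∈ Icc x y, z ∈ Ioo (t - r) (t + r) := fun z hz =>
          ⟨hxr.trans_le hz.1, hz.2.trans_lt hyr⟩
        have hxs := hsub (hin x ⟨le_rfl, hxy⟩)
        have hys := hsub (hin y ⟨hxy, le_rfl⟩)
        refine ⟨_, _, Att.single hxy ⟨ht, hxs.1.2.1, hys.1.2.2⟩,
          Att.single hxy ⟨i.2, hxs.2.2.1, hys.2.2.2⟩, ?_⟩
        simp only [hF, map_smul, smul_eq_mul]
        rw [← mul_sub]
        refine hbound x y _ ⟨h0, by linarith⟩ ⟨by linarith, h1⟩ hxy fun z hz => ?_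
        have hzs := hsub (hin z hz)
        have h2 : (s z : ℝ) < s t + ε := hzs.1.1
        have h3 : |e (g i)| ≤ M := (hele _).trans (hM i hi)
        simp only [hu, indicator_of_mem hzs.2.1]
        have h4 : 0 < s t := pos_iff_ne_zero.2 hst
        have h5 : (s t : ℝ≥0∞) ≤ ENNReal.ofReal (e (g t)) := by
          have := (ENNReal.coe_le_coe.2 (hsφ t)).trans (hφ t)
          rwa [indicator_of_mem htE] at this
        have h6 : (s t : ℝ) ≤ e (g t) := by
          rw [← ENNReal.ofReal_coe_nnreal] at h5
          by_contra hlt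
          rw [not_le] at hlt
          exact absurd h5 (not_le.2 ((ENNReal.ofReal_lt_ofReal_iff (by exact_mod_cast h4)).2 hlt))
        linarith [(abs_le.1 h3).2]
      · rw [not_ne_iff] at hst
        obtain ⟨r, hr, hsub⟩ := (nhds_basis_Ioo_pos t).mem_iff.1 (inter_mem hlt hIoo)
        refine ⟨r, hr, fun x y h0 hx hy h1 hxr hyr => ?_⟩
        have hxy := hx.trans hy
        have hin : ∀ z ∈ Icc x y, z ∈ Ioo (t - r) (t + r) := fun z hz =>
          ⟨hxr.trans_le hz.1, hz.2.trans_lt hyr⟩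
        have hA : Att R F x y (F x y t) := Att.single hxy
          ⟨ht, (hsub (hin x ⟨le_rfl, hxy⟩)).2.1, (hsub (hin y ⟨hxy, le_rfl⟩)).2.2⟩
        refine ⟨_, _, hA, hA, ?_⟩
        rw [sub_self, ← mul_zero (y - x)]
        refine hbound x y _ ⟨h0, by linarith⟩ ⟨by linarith, h1⟩ hxy fun z hz => ?_
        have h2 : (s z : ℝ) < s t + ε := (hsub (hin z hz)).1
        rw [hst, NNReal.coe_zero] at h2
        have h3 : 0 ≤ U.indicator (fun _ => M) z := indicator_nonneg (fun _ _ => hM0.le) z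
        simp only [hu]
        linarith
  obtain ⟨S, S', hS, hS', hSS⟩ := hcous
  have hclose : ∀ S, Att R F 0 1 S → ‖w - S‖ < ε := fun S hS => by
    obtain ⟨n, P, hP, rfl⟩ := hS.exists_TP fun x y t h => h.1
    exact hδw n P fun i z hz => ⟨(hP i).2.1.trans_le hz.1, hz.2.trans_lt (hP i).2.2⟩
  have hSε : e S - e S' ≤ 2 * ε := by
    rw [← map_sub]
    refine (le_abs_self _).trans ((hele _).trans ?_)
    rw [show S - S' = (w - S') - (w - S) by abel]
    refine (norm_sub_le _ _).trans ?_
    linarith [hclose S hS, hclose S' hS']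
  have hsint : ∫ x in Icc (0 : ℝ) 1, (s x : ℝ) ≤ 4 * ε := by
    simp only [hu] at hSS
    rw [intervalIntegral.integral_of_le zero_le_one, ← integral_Icc_eq_integral_Ioc,
      integral_sub (f := fun x => (s x : ℝ) - ε) (hsi.sub hci) hUi, integral_sub hsi hci, integral_indicator hUo.measurableSet,
      setIntegral_const, setIntegral_const, Real.volume_real_Icc_of_le zero_le_one] at hSS
    have h1 : (volume.restrict (Icc (0 : ℝ) 1)).real U ≤ ε / M :=
      ENNReal.toReal_le_of_le_ofReal (by positivity) ((Measure.restrict_apply_le _ _).trans hUv.le)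
    rw [le_div_iff₀ hM0] at h1
    simp only [smul_eq_mul] at hSS
    linarith
  have hsE : ∫⁻ x, s x = ∫⁻ x in Icc (0 : ℝ) 1, s x :=
    (setLIntegral_eq_of_support_subset fun x hx => by
      by_contra hxE
      have := (hsφ x).trans (hφ0 x fun h => hxE (hEI h)).le
      exact hx (by simpa using this)).symm
  calc ∫⁻ x, φ x ≤ (∫⁻ x, s x) + ENNReal.ofReal ε := hs
    _ ≤ ENNReal.ofReal (4 * ε) + ENNReal.ofReal ε := by
      gcongr
      rw [hsE]
      have := ofReal_integral_eq_lintegral_ofReal hsi (ae_of_all _ fun x => (s x).2)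
      simp only [ENNReal.ofReal_coe_nnreal] at this
      rw [← this]
      exact ENNReal.ofReal_le_ofReal hsint
    _ = ENNReal.ofReal (5 * ε) := by
      rw [← ENNReal.ofReal_add (by positivity) hε.le]; ring_nf

theorem UI.of_lintegral {ι : Type*} {u : ι → ℝ → ℝ}
    (hm : ∀ b, AEStronglyMeasurable (u b) (volume.restrict (Icc 0 1)))
    (h : ∀ ε > 0, ∃ η > 0, ∀ E ⊆ Icc (0 : ℝ) 1, MeasurableSet E →
      volume E ≤ ENNReal.ofReal η → ∀ b, ∫⁻ t in E, ‖u b t‖ₑ ≤ ENNReal.ofReal ε) : UI u := by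
  have hint : ∀ b, IntegrableOn (u b) (Icc 0 1) := fun b => by
    obtain ⟨η, hη, hE⟩ := h 1 one_pos
    refine ⟨hm b, ?_⟩
    refine cousin (Q := fun x y => ∫⁻ t in Icc x y, ‖u b t‖ₑ < ∞) zero_le_one ?_ fun t ht => ?_
    · intro x y z _ hxy hyz _ h1 h2
      rw [← Icc_union_Icc_eq_Icc hxy hyz]
      exact (lintegral_union_le _ _ _).trans_lt (ENNReal.add_lt_top.2 ⟨h1, h2⟩)
    · refine ⟨η / 2, by positivity, fun x y h0 _ _ h1 hx hy => ?_⟩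
      refine (hE (Icc x y) (Icc_subset_Icc h0 h1) measurableSet_Icc ?_ b).trans_lt
        ENNReal.ofReal_lt_top
      rw [Real.volume_Icc]
      exact ENNReal.ofReal_le_ofReal (by linarith)
  refine ⟨hint, fun ε hε => ?_⟩
  obtain ⟨η, hη, hE⟩ := h ε hε
  refine ⟨η, hη, fun E hEI hEm hEv b => ?_⟩
  have := hE E hEI hEm hEv b
  rw [← ofReal_integral_norm_eq_lintegral_enorm ((hint b).mono_set hEI)] at this
  exact (ENNReal.ofReal_le_ofReal_iff hε.le).1 this

theorem UI.lintegral {ι : Type*} {u : ι → ℝ → ℝ} (hu : UI u) :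
    ∀ ε > 0, ∃ η > 0, ∀ E ⊆ Icc (0 : ℝ) 1, MeasurableSet E →
      volume E ≤ ENNReal.ofReal η → ∀ b, ∫⁻ t in E, ‖u b t‖ₑ ≤ ENNReal.ofReal ε := by
  intro ε hε
  obtain ⟨η, hη, hE⟩ := hu.2 ε hε
  refine ⟨η, hη, fun E hEI hEm hEv b => ?_⟩
  rw [← ofReal_integral_norm_eq_lintegral_enorm ((hu.1 b).mono_set hEI)]
  exact ENNReal.ofReal_le_ofReal (hE E hEI hEm hEv b)

/-- Domination by two members of a uniformly integrable family. -/
theorem UI.of_abs_le {ι κ : Type*} {u : ι → ℝ → ℝ} {f : κ → ℝ → ℝ} (hu : UI u)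
    (hm : ∀ b, AEStronglyMeasurable (f b) (volume.restrict (Icc 0 1))) {p q : κ → ι}
    (h : ∀ b, ∀ t ∈ Icc (0 : ℝ) 1, |f b t| ≤ |u (p b) t| + |u (q b) t|) : UI f := by
  refine .of_lintegral hm fun ε hε => ?_
  obtain ⟨η, hη, hE⟩ := hu.lintegral (ε / 2) (by positivity)
  refine ⟨η, hη, fun E hEI hEm hEv b => ?_⟩
  calc ∫⁻ t in E, ‖f b t‖ₑ ≤ ∫⁻ t in E, (‖u (p b) t‖ₑ + ‖u (q b) t‖ₑ) := by
        refine setLIntegral_mono' hEm fun t ht => ?_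
        simp only [Real.enorm_eq_ofReal_abs]
        rw [← ENNReal.ofReal_add (abs_nonneg _) (abs_nonneg _)]
        exact ENNReal.ofReal_le_ofReal (h b t (hEI ht))
    _ = (∫⁻ t in E, ‖u (p b) t‖ₑ) + ∫⁻ t in E, ‖u (q b) t‖ₑ :=
        lintegral_add_left' ((hu.1 (p b)).1.enorm.mono_measure (Measure.restrict_mono_set _ hEI)) _
    _ ≤ ENNReal.ofReal (ε / 2) + ENNReal.ofReal (ε / 2) :=
        add_le_add (hE E hEI hEm hEv _) (hE E hEI hEm hEv _)
    _ = ENNReal.ofReal ε := by rw [← ENNReal.ofReal_add (by positivity) (by positivity)]; simp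

theorem FMcShaneIntegrable.ui {g : ℝ → Y} (hg : FMcShaneIntegrable g)
    (hm : AEStronglyMeasurable g (volume.restrict (Icc 0 1))) :
    UI fun (e : {e : Y →L[ℝ] ℝ // ‖e‖ ≤ 1}) t => e.1 (g t) := by
  have hme : ∀ e : Y →L[ℝ] ℝ, AEStronglyMeasurable (fun t => e (g t)) (volume.restrict (Icc 0 1)) :=
    fun e => e.continuous.comp_aestronglyMeasurable hm
  refine .of_lintegral (fun e => hme e.1) fun ε hε => ?_
  obtain ⟨η, hη, hE⟩ := hg.exists_lintegral_le (show 0 < ε / 10 by positivity)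
  refine ⟨η, hη, fun E hEI hEm hEv e => ?_⟩
  have h1 := hE E hEI hEm hEv e.1 e.2
  have h2 := hE E hEI hEm hEv (-e.1) (by rw [norm_neg]; exact e.2)
  calc ∫⁻ t in E, ‖e.1 (g t)‖ₑ
      = ∫⁻ t in E, (ENNReal.ofReal (e.1 (g t)) + ENNReal.ofReal ((-e.1) (g t))) := by
        refine lintegral_congr fun t => ?_
        rw [Real.enorm_eq_ofReal_abs, neg_apply]
        rcases le_total 0 (e.1 (g t)) with h | h
        · rw [abs_of_nonneg h, ENNReal.ofReal_of_nonpos (p := -e.1 (g t)) (by linarith), add_zero]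
        · rw [abs_of_nonpos h, ENNReal.ofReal_of_nonpos (p := e.1 (g t)) h, zero_add]
    _ = (∫⁻ t in E, ENNReal.ofReal (e.1 (g t))) + ∫⁻ t in E, ENNReal.ofReal ((-e.1) (g t)) :=
        lintegral_add_left' ((hme e.1).aemeasurable.ennreal_ofReal.mono_measure
          (Measure.restrict_mono_set _ hEI)) _
    _ ≤ _ := add_le_add h1 h2
    _ = ENNReal.ofReal ε := by
        rw [← ENNReal.ofReal_add (by positivity) (by positivity)]; ring_nf

theorem exists_dual_norm_le_one (x : Y) : ∃ e : {e : Y →L[ℝ] ℝ // ‖e‖ ≤ 1}, e.1 x = ‖x‖ := by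
  obtain ⟨e, he, hx⟩ := exists_dual_vector'' ℝ x
  exact ⟨⟨e, he⟩, by simpa using hx⟩

/-- A strongly measurable function which is uniformly scalarly integrable is Pettis integrable. -/
theorem UI.fPettisIntegrable [CompleteSpace Y] {f : ℝ → Y}
    (hf : AEStronglyMeasurable f (volume.restrict (Icc 0 1)))
    (hui : UI fun (e : {e : Y →L[ℝ] ℝ // ‖e‖ ≤ 1}) t => e.1 (f t)) : FPettisIntegrable f := by
  have hint : ∀ x' : Y →L[ℝ] ℝ, IntegrableOn (fun t => x' (f t)) (Icc (0 : ℝ) 1) := fun x' => by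
    have h1 : ‖(‖x'‖ + 1)⁻¹ • x'‖ ≤ 1 := by
      rw [norm_smul, norm_inv, Real.norm_of_nonneg (by positivity), inv_mul_le_iff₀ (by positivity)]
      linarith
    refine ((hui.1 ⟨_, h1⟩).const_mul (‖x'‖ + 1)).congr (ae_of_all _ fun t => ?_)
    simp only [smul_apply, smul_eq_mul]
    field_simp
  refine ⟨hint, fun E hEI hEm => ?_⟩
  obtain ⟨f', hf', hff⟩ := hf
  set A : ℕ → Set ℝ := fun n => {t | ‖f' t‖ ≤ n} with hA
  have hAm : ∀ n, MeasurableSet (A n) := fun n =>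
    measurableSet_le hf'.norm.measurable measurable_const
  have hffE : f =ᵐ[volume.restrict E] f' := ae_restrict_of_ae_restrict_of_subset hEI hff
  have hEfin : volume E < ∞ := (measure_mono hEI).trans_lt (by simp)
  have hfi : ∀ n, IntegrableOn f' (A n) (volume.restrict E) := fun n => by
    have : IsFiniteMeasure (volume.restrict E) := ⟨by simpa using hEfin⟩
    refine (integrable_const (n : ℝ)).mono' hf'.aestronglyMeasurable.restrict ?_
    exact (ae_restrict_iff' (hAm n)).2 (ae_of_all _ fun t ht => ht)
  set ν : ℕ → Y := fun n => ∫ t in A n, f' t ∂(volume.restrict E) with hν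
  have hνe : ∀ (e : Y →L[ℝ] ℝ) n, e (ν n) = ∫ t in A n, e (f t) ∂(volume.restrict E) := fun e n => by
    rw [hν, ← e.integral_comp_comm (hfi n)]
    refine integral_congr_ae ?_
    filter_upwards [ae_restrict_of_ae hffE] with t ht
    rw [ht]
  have hAmono : Monotone A := fun m n hmn t (ht : ‖f' t‖ ≤ m) =>
    ht.trans (by exact_mod_cast hmn)
  have hlim : Tendsto (fun n => volume ((A n)ᶜ ∩ Icc 0 1)) atTop (𝓝 0) := by
    have hempty : ⋂ n, ((A n)ᶜ ∩ Icc (0 : ℝ) 1) = ∅ := by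
      refine eq_empty_of_forall_notMem fun t ht => ?_
      obtain ⟨n, hn⟩ := exists_nat_ge ‖f' t‖
      exact (mem_iInter.1 ht n).1 hn
    rw [← measure_empty (μ := (volume : Measure ℝ)), ← hempty]
    refine tendsto_measure_iInter_atTop
      (fun n => ((hAm n).compl.inter measurableSet_Icc).nullMeasurableSet)
      (fun m n hmn => inter_subset_inter_left _ (compl_subset_compl.2 (hAmono hmn))) ⟨0, ?_⟩
    exact ((measure_mono inter_subset_right).trans_lt (by simp)).ne
  have hcauchy : CauchySeq ν := by
    refine Metric.cauchySeq_iff'.2 fun ε hε => ?_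
    obtain ⟨η, hη, hηE⟩ := hui.2 (ε / 2) (by positivity)
    obtain ⟨N, hN⟩ := (hlim.eventually_le_const (ENNReal.ofReal_pos.2 hη)).exists
    refine ⟨N, fun n hn => ?_⟩
    rw [dist_eq_norm]
    obtain ⟨e, he⟩ := exists_dual_norm_le_one (ν n - ν N)
    rw [← he, map_sub, hνe, hνe]
    have hi : IntegrableOn (fun t => e.1 (f t)) (A n) (volume.restrict E) :=
      ((hui.1 e).mono_set hEI).integrableOn
    rw [← setIntegral_sdiff (hAm N) hi (hAmono hn)]
    have h1 := hηE ((A N)ᶜ ∩ Icc 0 1) inter_subset_right ((hAm N).compl.inter measurableSet_Icc)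
      hN e
    refine lt_of_le_of_lt ?_ (show ε / 2 < ε by linarith)
    simp only [← Real.norm_eq_abs] at h1
    refine (Real.le_norm_self _).trans ((norm_integral_le_integral_norm _).trans (le_trans ?_ h1))
    rw [Measure.restrict_restrict ((hAm n).diff (hAm N))]
    refine setIntegral_mono_set ((hui.1 e).mono_set inter_subset_right).norm
      (ae_of_all _ fun _ => norm_nonneg _) ?_
    exact ae_of_all _ fun t ht => ⟨ht.1.2, hEI ht.2⟩
  obtain ⟨x, hx⟩ := cauchySeq_tendsto_of_complete hcauchy
  refine ⟨x, fun e => ?_⟩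
  refine tendsto_nhds_unique ((e.continuous.tendsto x).comp hx) ?_
  have : Function.comp e ν = fun n => ∫ t in A n, e (f t) ∂(volume.restrict E) := by
    ext n; exact hνe e n
  rw [this]
  have hun : ⋃ n, A n = univ := eq_univ_of_forall fun t => by
    obtain ⟨n, hn⟩ := exists_nat_ge ‖f' t‖
    exact mem_iUnion.2 ⟨n, hn⟩
  have := tendsto_setIntegral_of_monotone hAm hAmono (f := fun t => e (f t))
    (μ := volume.restrict E) (by rw [hun]; exact ((hint e).mono_set hEI).integrableOn)
  rwa [hun, Measure.restrict_univ] at this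

theorem le_suppFn {A : Set X} (hA : Bornology.IsBounded A) (x' : X →L[ℝ] ℝ) {x : X} (hx : x ∈ A) :
    x' x ≤ suppFn x' A :=
  le_csSup (x'.lipschitz.isBounded_image hA).bddAbove (mem_image_of_mem _ hx)

theorem suppFn_le {A : Set X} (hA : A.Nonempty) {x' : X →L[ℝ] ℝ} {C : ℝ}
    (h : ∀ x ∈ A, x' x ≤ C) : suppFn x' A ≤ C :=
  csSup_le (hA.image _) (forall_mem_image.2 h)

theorem suppFn_add {A B : Set X} (hA : A.Nonempty) (hA' : Bornology.IsBounded A)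
    (hB : B.Nonempty) (hB' : Bornology.IsBounded B) (x' : X →L[ℝ] ℝ) :
    suppFn x' (A + B) = suppFn x' A + suppFn x' B := by
  unfold suppFn
  rw [image_add, csSup_add (hA.image _) (x'.lipschitz.isBounded_image hA').bddAbove
    (hB.image _) (x'.lipschitz.isBounded_image hB').bddAbove]

theorem suppFn_smul_set {c : ℝ} (hc : 0 ≤ c) (A : Set X) (x' : X →L[ℝ] ℝ) :
    suppFn x' (c • A) = c * suppFn x' A := by
  unfold suppFn
  rw [image_smul_set, Real.sSup_smul_of_nonneg hc, smul_eq_mul]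

theorem suppFn_smul {c : ℝ} (hc : 0 ≤ c) (A : Set X) (x' : X →L[ℝ] ℝ) :
    suppFn (c • x') A = c * suppFn x' A := by
  unfold suppFn
  rw [← smul_eq_mul, ← Real.sSup_smul_of_nonneg hc, ← image_smul, image_image]
  rfl

theorem abs_suppFn_le {A : Set X} (hA : A.Nonempty) {C : ℝ} (hC : ∀ x ∈ A, ‖x‖ ≤ C)
    (x' : X →L[ℝ] ℝ) : |suppFn x' A| ≤ ‖x'‖ * C := by
  have hb : ∀ x ∈ A, |x' x| ≤ ‖x'‖ * C := fun x hx =>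
    (x'.le_opNorm x).trans (mul_le_mul_of_nonneg_left (hC x hx) (norm_nonneg _))
  refine abs_le.2 ⟨?_, suppFn_le hA fun x hx => (le_abs_self _).trans (hb x hx)⟩
  obtain ⟨x, hx⟩ := hA
  exact (abs_le.1 (hb x hx)).1.trans (le_suppFn (isBounded_iff_forall_norm_le.2 ⟨C, hC⟩) x' hx)

theorem neg_suppFn_neg_le {A : Set X} (hA : Bornology.IsBounded A) (x' : X →L[ℝ] ℝ) {x : X}
    (hx : x ∈ A) : -suppFn (-x') A ≤ x' x := by
  have := le_suppFn hA (-x') hx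
  rw [neg_apply] at this
  linarith

theorem IsCWK.exists_eq_suppFn {A : Set X} (hA : IsCWK X A) (x' : X →L[ℝ] ℝ) :
    ∃ x ∈ A, x' x = suppFn x' A := by
  have hc : Continuous fun y : WeakSpace ℝ X => x' ((toWeakSpace ℝ X).symm y) :=
    WeakBilin.eval_continuous _ x'
  obtain ⟨y, ⟨x, hx, rfl⟩, hy⟩ := hA.2.2.exists_isMaxOn (hA.1.image _) hc.continuousOn
  have hm : ∀ z ∈ A, x' z ≤ x' x := fun z hz => hy (mem_image_of_mem _ hz)
  exact ⟨x, hx, le_antisymm (le_csSup ⟨_, forall_mem_image.2 hm⟩ (mem_image_of_mem _ hx))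
    (suppFn_le hA.1 hm)⟩

theorem IsCWK.isBounded {A : Set X} (hA : IsCWK X A) : Bornology.IsBounded A := by
  have hpt : ∀ x' : X →L[ℝ] ℝ, ∃ C, ∀ x : A, ‖NormedSpace.inclusionInDoubleDual ℝ X x x'‖ ≤ C := by
    intro x'
    have hc : Continuous fun y : WeakSpace ℝ X => ‖x' ((toWeakSpace ℝ X).symm y)‖ :=
      (WeakBilin.eval_continuous _ x').norm
    obtain ⟨C, hC⟩ := hA.2.2.bddAbove_image hc.continuousOn
    exact ⟨C, fun x => hC ⟨toWeakSpace ℝ X x, mem_image_of_mem _ x.2, rfl⟩⟩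
  obtain ⟨C, hC⟩ := banach_steinhaus hpt
  refine isBounded_iff_forall_norm_le.2 ⟨C, fun x hx => ?_⟩
  have := hC ⟨x, hx⟩
  rwa [show ‖NormedSpace.inclusionInDoubleDual ℝ X x‖ = ‖x‖ from
    (NormedSpace.inclusionInDoubleDualLi ℝ).norm_map x] at this

/-- The space of bounded functions on the dual unit ball, in which the convex bounded sets embed
through their support functions. -/
abbrev SuppSpace (X : Type*) [NormedAddCommGroup X] [NormedSpace ℝ X] : Type _ :=
  lp (fun _ : {e : X →L[ℝ] ℝ // ‖e‖ ≤ 1} => ℝ) ∞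

open Classical in
/-- The Rådström embedding `A ↦ σ(·, A)`. -/
noncomputable def emb (A : Set X) : SuppSpace X :=
  if h : Memℓp (fun b : {e : X →L[ℝ] ℝ // ‖e‖ ≤ 1} => suppFn b.1 A) ∞ then ⟨_, h⟩ else 0

/-- Nonempty convex bounded sets. -/
def BddConv (A : Set X) : Prop := A.Nonempty ∧ Convex ℝ A ∧ Bornology.IsBounded A

theorem IsCWK.bddConv {A : Set X} (hA : IsCWK X A) : BddConv A := ⟨hA.1, hA.2.1, hA.isBounded⟩

theorem BddConv.add {A B : Set X} (hA : BddConv A) (hB : BddConv B) : BddConv (A + B) :=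
  ⟨hA.1.add hB.1, hA.2.1.add hB.2.1, hA.2.2.add hB.2.2⟩

theorem BddConv.smul {A : Set X} (hA : BddConv A) (c : ℝ) : BddConv (c • A) :=
  ⟨hA.1.smul_set, hA.2.1.smul c, hA.2.2.smul₀ c⟩

theorem BddConv.emb_apply {A : Set X} (hA : BddConv A) (b : {e : X →L[ℝ] ℝ // ‖e‖ ≤ 1}) :
    (emb A : SuppSpace X) b = suppFn b.1 A := by
  obtain ⟨C, hC⟩ := isBounded_iff_forall_norm_le.1 hA.2.2
  have hm : Memℓp (fun b : {e : X →L[ℝ] ℝ // ‖e‖ ≤ 1} => suppFn b.1 A) ∞ := by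
    refine memℓp_infty ⟨C, ?_⟩
    rintro _ ⟨e, rfl⟩
    have h0 : 0 ≤ C := (norm_nonneg _).trans (hC _ hA.1.some_mem)
    exact (abs_suppFn_le hA.1 hC e.1).trans (mul_le_of_le_one_left h0 e.2)
  rw [emb, dif_pos hm]

theorem BddConv.emb_add {A B : Set X} (hA : BddConv A) (hB : BddConv B) :
    emb (A + B) = emb A + emb B := by
  ext b
  rw [lp.coeFn_add, Pi.add_apply, (hA.add hB).emb_apply, hA.emb_apply, hB.emb_apply,
    suppFn_add hA.1 hA.2.2 hB.1 hB.2.2]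

theorem BddConv.emb_smul {A : Set X} (hA : BddConv A) {c : ℝ} (hc : 0 ≤ c) :
    emb (c • A) = c • emb A := by
  ext b
  rw [lp.coeFn_smul, Pi.smul_apply, (hA.smul c).emb_apply, hA.emb_apply, suppFn_smul_set hc,
    smul_eq_mul]

theorem BddConv.sum {ι : Type*} (s : Finset ι) {A : ι → Set X} (hA : ∀ i ∈ s, BddConv (A i)) :
    BddConv (∑ i ∈ s, A i) ∧ emb (∑ i ∈ s, A i) = ∑ i ∈ s, emb (A i) := by
  classical
  induction s using Finset.induction_on with
  | empty =>
    have h0 : BddConv (0 : Set X) :=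
      ⟨singleton_nonempty _, convex_singleton _, Bornology.isBounded_singleton⟩
    refine ⟨by simpa using h0, ?_⟩
    rw [Finset.sum_empty, Finset.sum_empty]
    have := h0.emb_smul (c := 0) le_rfl
    rwa [smul_zero, zero_smul] at this
  | insert a s ha ih =>
    rw [Finset.sum_insert ha, Finset.sum_insert ha]
    obtain ⟨h1, h2⟩ := ih fun i hi => hA i (Finset.mem_insert_of_mem hi)
    have h3 := hA a (Finset.mem_insert_self _ _)
    exact ⟨h3.add h1, by rw [h3.emb_add h1, h2]⟩

theorem BddConv.infDist_le {A B : Set X} (hA : BddConv A) (hB : BddConv B) {a : X} (ha : a ∈ A) :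
    infDist a B ≤ ‖emb A - emb B‖ := by
  by_contra! hlt
  obtain ⟨r, hr, hr'⟩ := exists_between hlt
  have hr0 : 0 < r := (norm_nonneg _).trans_lt hr
  have hdisj : Disjoint (ball a r) B := by
    refine disjoint_left.2 fun y hy hyB => ?_
    have := infDist_le_dist_of_mem (x := a) hyB
    rw [mem_ball, dist_comm] at hy
    linarith
  obtain ⟨f, u, h1, h2⟩ := geometric_hahn_banach_open (convex_ball a r) isOpen_ball hB.2.1 hdisj
  have hu : f a + r * ‖f‖ ≤ u := by
    by_contra! hcon
    have : (u - f a) / r < ‖f‖ := by rw [div_lt_iff₀ hr0]; linarith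
    obtain ⟨z, hz, hfz⟩ := f.exists_lt_apply_of_lt_opNorm this
    have key : ∀ w : X, ‖w‖ < 1 → f w ≤ (u - f a) / r := fun w hw => by
      have := h1 (a + r • w) (by
        rw [mem_ball, dist_eq_norm, add_sub_cancel_left, norm_smul, Real.norm_of_nonneg hr0.le]
        exact mul_lt_of_lt_one_right hr0 hw)
      rw [map_add, map_smul, smul_eq_mul] at this
      rw [le_div_iff₀ hr0]; linarith
    rcases abs_cases (f z) with ⟨h, _⟩ | ⟨h, _⟩
    · rw [Real.norm_eq_abs, h] at hfz
      exact absurd (key z hz) (not_le.2 hfz)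
    · rw [Real.norm_eq_abs, h, ← map_neg] at hfz
      exact absurd (key (-z) (by rwa [norm_neg])) (not_le.2 hfz)
  have hf0 : 0 < ‖f‖ := by
    refine norm_pos_iff.2 fun h => ?_
    obtain ⟨b, hb⟩ := hB.1
    have h3 := h1 a (mem_ball_self hr0)
    have h4 := h2 b hb
    simp only [h, zero_apply] at h3 h4
    linarith
  set e : {e : X →L[ℝ] ℝ // ‖e‖ ≤ 1} := ⟨-(‖f‖⁻¹ • f), by
    rw [norm_neg, norm_smul, norm_inv, norm_norm, inv_mul_cancel₀ hf0.ne']⟩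
  have h5 := lp.norm_apply_le_norm (by simp) (emb A - emb B) e
  rw [lp.coeFn_sub, Pi.sub_apply, hA.emb_apply, hB.emb_apply] at h5
  have h6 : e.1 a ≤ suppFn e.1 A := le_suppFn hA.2.2 _ ha
  have h7 : suppFn e.1 B ≤ e.1 a - r := by
    refine suppFn_le hB.1 fun x hx => ?_
    have h8 := hu.trans (h2 x hx)
    have : e.1 a - r - e.1 x = ‖f‖⁻¹ * (f x - (f a + r * ‖f‖)) := by
      simp only [e, neg_apply, smul_apply, smul_eq_mul]
      field_simp; ring
    have h9 : 0 ≤ ‖f‖⁻¹ * (f x - (f a + r * ‖f‖)) :=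
      mul_nonneg (inv_nonneg.2 hf0.le) (sub_nonneg.2 h8)
    linarith
  have := (Real.le_norm_self _).trans h5
  linarith

theorem BddConv.hausdorffEDist_ne_top {A B : Set X} (hA : BddConv A) (hB : BddConv B) :
    hausdorffEDist A B ≠ ⊤ :=
  hausdorffEDist_ne_top_of_nonempty_of_bounded hA.1 hB.1 hA.2.2 hB.2.2

theorem BddConv.suppFn_le_add {A B : Set X} (hA : BddConv A) (hB : BddConv B)
    (b : {e : X →L[ℝ] ℝ // ‖e‖ ≤ 1}) :
    suppFn b.1 A ≤ suppFn b.1 B + hausdorffDist A B := by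
  refine suppFn_le hA.1 fun x hx => ?_
  refine le_of_forall_pos_le_add fun ε hε => ?_
  obtain ⟨y, hy, hxy⟩ := exists_dist_lt_of_hausdorffDist_lt hx (lt_add_of_pos_right _ hε)
    (hA.hausdorffEDist_ne_top hB)
  have h1 := le_suppFn hB.2.2 b.1 hy
  have h2 : b.1 x - b.1 y ≤ dist x y := by
    rw [← map_sub, dist_eq_norm]
    exact (Real.le_norm_self _).trans ((b.1.le_opNorm _).trans
      (mul_le_of_le_one_left (norm_nonneg _) b.2))
  linarith

/-- The Hausdorff distance is the uniform distance of support functions on the dual ball. -/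
theorem BddConv.hausdorffDist_eq {A B : Set X} (hA : BddConv A) (hB : BddConv B) :
    hausdorffDist A B = ‖emb A - emb B‖ := by
  refine le_antisymm ?_ ?_
  · refine hausdorffDist_le_of_infDist (norm_nonneg _) (fun x hx => hA.infDist_le hB hx)
      fun x hx => ?_
    rw [norm_sub_rev]
    exact hB.infDist_le hA hx
  · refine lp.norm_le_of_forall_le hausdorffDist_nonneg fun b => ?_
    rw [lp.coeFn_sub, Pi.sub_apply, hA.emb_apply, hB.emb_apply, Real.norm_eq_abs, abs_le]
    have h1 := hA.suppFn_le_add hB b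
    have h2 := hB.suppFn_le_add hA b
    rw [hausdorffDist_comm] at h2
    constructor <;> linarith

/-- Evaluation of an element of `SuppSpace X` at an arbitrary functional, by positive
homogeneity. -/
noncomputable def evalAt (x' : X →L[ℝ] ℝ) : SuppSpace X →L[ℝ] ℝ :=
  (‖x'‖ + 1) • lp.evalCLM ℝ (fun _ : {e : X →L[ℝ] ℝ // ‖e‖ ≤ 1} => ℝ) ∞
    ⟨(‖x'‖ + 1)⁻¹ • x', by
      rw [norm_smul, norm_inv, Real.norm_of_nonneg (by positivity), inv_mul_le_iff₀ (by positivity)]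
      linarith⟩

theorem BddConv.evalAt_emb {A : Set X} (hA : BddConv A) (x' : X →L[ℝ] ℝ) :
    evalAt x' (emb A) = suppFn x' A := by
  have : evalAt x' (emb A) = (‖x'‖ + 1) * (emb A : SuppSpace X) ⟨(‖x'‖ + 1)⁻¹ • x', by
      rw [norm_smul, norm_inv, Real.norm_of_nonneg (by positivity), inv_mul_le_iff₀ (by positivity)]
      linarith⟩ := rfl
  rw [this, hA.emb_apply, suppFn_smul (by positivity), ← mul_assoc,
    mul_inv_cancel₀ (by positivity), one_mul]

theorem IsCWK.of_forall_le {W W' : Set X} (hW : IsCWK X W) (p : (X →L[ℝ] ℝ) → ℝ)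
    (hW' : W' = {x ∈ W | ∀ x' : X →L[ℝ] ℝ, x' x ≤ p x'}) (hne : W'.Nonempty) : IsCWK X W' := by
  refine ⟨hne, ?_, ?_⟩
  · have : W' = W ∩ ⋂ x' : X →L[ℝ] ℝ, {x | x' x ≤ p x'} := by
      ext x
      simp [hW']
    rw [this]
    exact hW.2.1.inter (convex_iInter fun x' =>
      convex_halfSpace_le x'.toLinearMap.isLinear (p x'))
  · have : toWeakSpace ℝ X '' W' = toWeakSpace ℝ X '' W ∩
        ⋂ x' : X →L[ℝ] ℝ, {y | x' ((toWeakSpace ℝ X).symm y) ≤ p x'} := by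
      ext y
      simp only [hW', mem_image, mem_inter_iff, mem_iInter, mem_ofPred_eq]
      constructor
      · rintro ⟨x, ⟨hx, hp⟩, rfl⟩
        exact ⟨⟨x, hx, rfl⟩, hp⟩
      · rintro ⟨⟨x, hx, rfl⟩, hp⟩
        exact ⟨x, ⟨hx, hp⟩, rfl⟩
    rw [this]
    exact hW.2.2.inter_right (isClosed_iInter fun x' =>
      isClosed_le (WeakBilin.eval_continuous _ x') continuous_const)

theorem IsCWK.add_singleton {W : Set X} (hW : IsCWK X W) (z : X) : IsCWK X (W + {z}) := by
  refine ⟨hW.1.add (singleton_nonempty z), hW.2.1.add (convex_singleton z), ?_⟩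
  rw [image_add, image_singleton]
  exact hW.2.2.add isCompact_singleton

/-- A linear functional on the dual dominated by the support function of a convex weakly compact
set `W` is the evaluation at a point of `W`. -/
theorem IsCWK.exists_eq_of_le {W : Set X} (hW : IsCWK X W) (l : (X →L[ℝ] ℝ) →ₗ[ℝ] ℝ)
    (hl : ∀ x', l x' ≤ suppFn x' W) : ∃ x ∈ W, ∀ x' : X →L[ℝ] ℝ, x' x = l x' := by
  have hcont : ∀ x' : X →L[ℝ] ℝ,
      Continuous fun y : WeakSpace ℝ X => x' ((toWeakSpace ℝ X).symm y) :=
    fun x' => WeakBilin.eval_continuous _ x'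
  obtain ⟨y, ⟨x, hx, rfl⟩, hy⟩ := hW.2.2.inter_iInter_nonempty
    (fun x' : X →L[ℝ] ℝ => {y | x' ((toWeakSpace ℝ X).symm y) = l x'})
    (fun x' => isClosed_eq (hcont x') continuous_const) fun u => by
      let T : X →ₗ[ℝ] (u → ℝ) := LinearMap.pi fun i => (i.1 : X →L[ℝ] ℝ).toLinearMap
      have hTc : IsCompact (T '' W) := by
        have : T '' W = (fun (y : WeakSpace ℝ X) (i : u) => i.1 ((toWeakSpace ℝ X).symm y)) ''
            (toWeakSpace ℝ X '' W) := by
          rw [image_image]; rfl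
        rw [this]
        exact hW.2.2.image (continuous_pi fun i => hcont i.1)
      by_cases hmem : (fun i : u => l i.1) ∈ T '' W
      · obtain ⟨x, hx, hxT⟩ := hmem
        refine ⟨toWeakSpace ℝ X x, mem_image_of_mem _ hx, mem_iInter₂.2 fun i hi => ?_⟩
        exact congrFun hxT ⟨i, hi⟩
      · exfalso
        obtain ⟨f, r, h1, h2⟩ := geometric_hahn_banach_closed_point
          (hW.2.1.linear_image T) hTc.isClosed hmem
        classical
        have hf : ∀ v : u → ℝ, f v = ∑ i, v i * f (Pi.single i 1) := fun v => by
          conv_lhs => rw [← Finset.univ_sum_single v, map_sum]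
          refine Finset.sum_congr rfl fun i _ => ?_
          rw [← smul_eq_mul, ← map_smul, ← Pi.single_smul, smul_eq_mul, mul_one]
        set x' : X →L[ℝ] ℝ := ∑ i : u, f (Pi.single i 1) • i.1 with hx'
        have h3 : suppFn x' W ≤ r := suppFn_le hW.1 fun x hx => by
          refine le_of_eq_of_le ?_ (h1 _ (mem_image_of_mem T hx)).le
          rw [hf, hx', _root_.sum_apply]
          exact Finset.sum_congr rfl fun i _ => mul_comm _ _
        have h4 : l x' = f fun i : u => l i.1 := by
          rw [hf, hx', map_sum]
          refine Finset.sum_congr rfl fun i _ => ?_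
          rw [map_smul, smul_eq_mul, mul_comm]
        have := hl x'
        linarith
  exact ⟨x, hx, fun x' => mem_iInter.1 hy x'⟩

/-- A sublinear functional on the dual dominated by the support function of a convex weakly compact
set is the support function of a convex weakly compact set. -/
theorem IsCWK.exists_suppFn_eq {W : Set X} (hW : IsCWK X W) (p : (X →L[ℝ] ℝ) → ℝ)
    (hhom : ∀ c : ℝ, 0 < c → ∀ x', p (c • x') = c * p x')
    (hadd : ∀ x' y', p (x' + y') ≤ p x' + p y') (hp : ∀ x', p x' ≤ suppFn x' W) :
    ∃ W' : Set X, IsCWK X W' ∧ ∀ x', suppFn x' W' = p x' := by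
  have h0 : p 0 = 0 := by
    have := hhom 2 two_pos 0
    rw [smul_zero] at this; linarith
  set W' : Set X := {x ∈ W | ∀ x' : X →L[ℝ] ℝ, x' x ≤ p x'} with hW'
  have key : ∀ x' : X →L[ℝ] ℝ, ∃ x ∈ W', x' x = p x' := fun x' => by
    have hext : ∃ l : (X →L[ℝ] ℝ) →ₗ[ℝ] ℝ, l x' = p x' ∧ ∀ y', l y' ≤ p y' := by
      rcases eq_or_ne x' 0 with rfl | hx'
      · obtain ⟨l, -, h2⟩ := exists_extension_of_le_sublinear (E := X →L[ℝ] ℝ) ⟨⊥, 0⟩ p hhom hadd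
          (by rintro ⟨y, hy⟩; rw [Submodule.mem_bot] at hy; subst hy; exact h0.ge)
        exact ⟨l, by rw [map_zero, h0], h2⟩
      · obtain ⟨l, h1, h2⟩ := exists_extension_of_le_sublinear
          (LinearPMap.mkSpanSingleton x' (p x') hx') p hhom hadd (by
            rintro ⟨y, hy⟩
            obtain ⟨c, rfl⟩ := Submodule.mem_span_singleton.1 hy
            have : LinearPMap.mkSpanSingleton x' (p x') hx' ⟨c • x', hy⟩ = c * p x' :=
              LinearPMap.mkSpanSingleton'_apply _ _ _ _ _
            rw [this]
            change c * p x' ≤ p (c • x')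
            rcases lt_trichotomy c 0 with hc | rfl | hc
            · have h3 := hadd (c • x') ((-c) • x')
              rw [← add_smul, add_neg_cancel, zero_smul, h0, hhom (-c) (by linarith)] at h3
              linarith
            · rw [zero_smul, h0, zero_mul]
            · exact (hhom c hc x').ge)
        refine ⟨l, ?_, h2⟩
        have h3 := h1 ⟨x', Submodule.mem_span_singleton_self x'⟩
        have h4 := LinearPMap.mkSpanSingleton_apply ℝ ℝ (σ := RingHom.id ℝ) hx' (p x')
        exact h3.trans h4
    obtain ⟨l, hl, hlp⟩ := hext
    obtain ⟨x, hx, hxl⟩ := hW.exists_eq_of_le l fun y' => (hlp y').trans (hp y')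
    exact ⟨x, ⟨hx, fun y' => (hxl y').trans_le (hlp y')⟩, (hxl x').trans hl⟩
  obtain ⟨x₀, hx₀, -⟩ := key 0
  have hcwk := hW.of_forall_le p hW' ⟨x₀, hx₀⟩
  refine ⟨W', hcwk, fun x' => le_antisymm (suppFn_le hcwk.1 fun x hx => hx.2 x') ?_⟩
  obtain ⟨x, hx, hxp⟩ := key x'
  exact hxp ▸ le_suppFn hcwk.isBounded x' hx

theorem IsCWK.exists_extreme {W : Set X} (hW : IsCWK X W) :
    ∃ x₀ ∈ W, ∀ x ∈ W, ∀ y ∈ W, x + y = (2 : ℝ) • x₀ → x = x₀ := by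
  have : LocallyConvexSpace ℝ (WeakSpace ℝ X) :=
    WeakBilin.locallyConvexSpace (B := (topDualPairing ℝ X).flip)
  obtain ⟨w, hw⟩ := hW.2.2.extremePoints_nonempty (hW.1.image _)
  rw [mem_extremePoints] at hw
  obtain ⟨⟨x₀, hx₀, rfl⟩, hext⟩ := hw
  refine ⟨x₀, hx₀, fun x hx y hy hxy => ?_⟩
  refine (toWeakSpace ℝ X).injective (hext _ (mem_image_of_mem _ hx) _ (mem_image_of_mem _ hy)
    ⟨1 / 2, 1 / 2, by norm_num, by norm_num, by norm_num, ?_⟩).1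
  rw [← map_smul, ← map_smul, ← map_add, ← smul_add, hxy, smul_smul]
  norm_num

theorem exists_additive_selection {Φ : ℝ → ℝ → Set X}
    (hΦ : ∀ a b : ℝ, 0 ≤ a → a ≤ b → b ≤ 1 → IsCWK X (Φ a b)) (hadd : AdditiveIntervalMF Φ) :
    ∃ F : ℝ → X, ∀ a b : ℝ, 0 ≤ a → a ≤ b → b ≤ 1 → F b - F a ∈ Φ a b := by
  obtain ⟨x₀, hx₀, hext⟩ := (hΦ 0 1 le_rfl zero_le_one le_rfl).exists_extreme
  have hex : ∀ t ∈ Icc (0 : ℝ) 1, ∃ p ∈ Φ 0 t, x₀ - p ∈ Φ t 1 := fun t ht => by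
    rw [hadd 0 t 1 le_rfl ht.1 ht.2 le_rfl] at hx₀
    obtain ⟨p, hp, q, hq, hpq⟩ := hx₀
    exact ⟨p, hp, by rwa [← hpq, add_sub_cancel_left]⟩
  choose! F hF hF' using hex
  have huniq : ∀ t ∈ Icc (0 : ℝ) 1, ∀ p ∈ Φ 0 t, x₀ - p ∈ Φ t 1 → p = F t := fun t ht p hp hq => by
    have hsum := hadd 0 t 1 le_rfl ht.1 ht.2 le_rfl
    have h1 : p + (x₀ - F t) ∈ Φ 0 1 := hsum ▸ add_mem_add hp (hF' t ht)
    have h2 : F t + (x₀ - p) ∈ Φ 0 1 := hsum ▸ add_mem_add (hF t ht) hq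
    have h3 := hext _ h1 _ h2 (by rw [two_smul]; abel)
    rw [add_comm, sub_add, sub_eq_self, sub_eq_zero] at h3
    exact h3.symm
  refine ⟨F, fun a b h0 hab h1 => ?_⟩
  have ha : a ∈ Icc (0 : ℝ) 1 := ⟨h0, hab.trans h1⟩
  have hb : b ∈ Icc (0 : ℝ) 1 := ⟨h0.trans hab, h1⟩
  have h3 := hF' a ha
  rw [hadd a b 1 h0 hab h1 le_rfl] at h3
  obtain ⟨v, hv, w, hw, hvw⟩ := h3
  have h4 : F a + v = F b := huniq b hb _
    (by rw [hadd 0 a b le_rfl h0 hab h1]; exact add_mem_add (hF a ha) hv)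
    (by rwa [← sub_sub, ← hvw, add_sub_cancel_left])
  rwa [← h4, add_sub_cancel_left]

theorem mem_closure_span_of_forall {s : Set X} {x : X}
    (h : ∀ x' : X →L[ℝ] ℝ, (∀ y ∈ s, x' y = 0) → x' x = 0) :
    x ∈ closure (Submodule.span ℝ s : Set X) := by
  by_contra hx
  obtain ⟨f, u, hfx, hfs⟩ := geometric_hahn_banach_point_closed
    (Submodule.span ℝ s).convex.closure isClosed_closure hx
  have hu : u < 0 := by
    simpa using hfs 0 (subset_closure (Submodule.zero_mem _))
  have h0 : ∀ y ∈ s, f y = 0 := fun y hy => by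
    by_contra hne
    have := hfs ((u / f y) • y)
      (subset_closure (Submodule.smul_mem _ _ (Submodule.subset_span hy)))
    rw [map_smul, smul_eq_mul, div_mul_cancel₀ _ hne] at this
    exact lt_irrefl _ this
  rw [h f h0] at hfx
  linarith

/-- A form of the Orlicz–Pettis theorem: a series all of whose subseries converge weakly has
arbitrarily small terms. -/
theorem exists_norm_le_of_hasSum_weak {z : ℕ → X} {ψ : (ℕ → Bool) → X}
    (h : ∀ (A : ℕ → Bool) (x' : X →L[ℝ] ℝ), HasSum (fun n => if A n then x' (z n) else 0) (x' (ψ A)))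
    {ε : ℝ} (hε : 0 < ε) : ∃ n, ‖z n‖ ≤ ε := by
  have hsep : TopologicalSpace.IsSeparable (closure (Submodule.span ℝ (range z) : Set X)) :=
    (((countable_range z).isSeparable).span (R := ℝ)).closure
  obtain ⟨c, hc, hcs⟩ := hsep
  have hψ : ∀ A, ψ A ∈ closure c := fun A => hcs <| mem_closure_span_of_forall fun x' hx' => by
    refine (h A x').unique ?_
    have : (fun n => if A n then x' (z n) else 0) = fun _ => (0 : ℝ) := by
      ext n
      rw [hx' _ (mem_range_self n), ite_self]
    rw [this]
    exact hasSum_zero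
  have hcont : ∀ x' : X →L[ℝ] ℝ, Continuous fun A => x' (ψ A) := fun x' => by
    have h1 : (fun A => x' (ψ A)) = fun A => ∑' n, if A n then x' (z n) else 0 :=
      funext fun A => (h A x').tsum_eq.symm
    have h2 : Summable fun n => ‖x' (z n)‖ := by
      have := (h (fun _ => true) x').summable
      simpa using this.norm
    rw [h1]
    refine continuous_tsum (fun n => ?_) h2 fun n A => ?_
    · exact (continuous_of_discreteTopology (f := fun b : Bool => if b then x' (z n) else 0)).comp
        (continuous_apply n)
    · split_ifs
      · exact le_rfl
      · simp
  have hcountable : Countable c := hc.to_subtype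
  have hclosed : ∀ j : c, IsClosed {A | ‖ψ A - j‖ ≤ ε / 2} := fun j => by
    have : {A | ‖ψ A - j‖ ≤ ε / 2} =
        ⋂ e : {e : X →L[ℝ] ℝ // ‖e‖ ≤ 1}, {A | e.1 (ψ A) - e.1 j ≤ ε / 2} := by
      ext A
      simp only [mem_ofPred_eq, mem_iInter]
      refine ⟨fun hA e => ?_, fun hA => ?_⟩
      · rw [← map_sub]
        exact (Real.le_norm_self _).trans ((e.1.le_opNorm _).trans
          ((mul_le_of_le_one_left (norm_nonneg _) e.2).trans hA))
      · obtain ⟨e, he⟩ := exists_dual_norm_le_one (ψ A - j)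
        rw [← he, map_sub]
        exact hA e
    rw [this]
    exact isClosed_iInter fun e => isClosed_le ((hcont e.1).sub continuous_const) continuous_const
  have hun : ⋃ j : c, {A | ‖ψ A - j‖ ≤ ε / 2} = univ := eq_univ_of_forall fun A => by
    obtain ⟨j, hj, hjd⟩ := Metric.mem_closure_iff.1 (hψ A) (ε / 2) (half_pos hε)
    rw [dist_eq_norm] at hjd
    exact mem_iUnion.2 ⟨⟨j, hj⟩, hjd.le⟩
  obtain ⟨j, A, hA⟩ := nonempty_interior_of_iUnion_of_closed hclosed hun
  have hA0 : ‖ψ A - j‖ ≤ ε / 2 := interior_subset (s := {A | ‖ψ A - j‖ ≤ ε / 2}) hA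
  have htend : Tendsto (fun n => Function.update A n (!A n)) atTop (𝓝 A) := by
    refine tendsto_pi_nhds.2 fun k => tendsto_const_nhds.congr' ?_
    filter_upwards [eventually_gt_atTop k] with n hn
    rw [Function.update_of_ne hn.ne]
  obtain ⟨n, hn⟩ := (htend.eventually (isOpen_interior.mem_nhds hA)).exists
  have hn0 : ‖ψ (Function.update A n (!A n)) - j‖ ≤ ε / 2 := interior_subset (s := {A | ‖ψ A - j‖ ≤ ε / 2}) hn
  refine ⟨n, ?_⟩
  set B := Function.update A n (!A n) with hB
  obtain ⟨e, he⟩ := exists_dual_norm_le_one (z n)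
  have hdiff : e.1 (ψ B) - e.1 (ψ A) = if B n then e.1 (z n) else -e.1 (z n) := by
    refine ((h B e.1).sub (h A e.1)).unique ?_
    have : (if B n then e.1 (z n) else -e.1 (z n)) =
        (if B n then e.1 (z n) else 0) - if A n then e.1 (z n) else 0 := by
      rw [hB, Function.update_self]
      cases A n <;> simp
    rw [this]
    refine hasSum_single n fun m hm => ?_
    rw [hB, Function.update_of_ne hm, sub_self]
  have h1 : ‖e.1 (ψ B) - e.1 (ψ A)‖ = ‖z n‖ := by
    rw [hdiff]
    split_ifs
    · rw [he, norm_norm]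
    · rw [norm_neg, he, norm_norm]
  rw [← h1, ← map_sub]
  refine (e.1.le_opNorm _).trans ((mul_le_of_le_one_left (norm_nonneg _) e.2).trans ?_)
  calc ‖ψ B - ψ A‖ = ‖(ψ B - j) - (ψ A - j)‖ := by rw [sub_sub_sub_cancel_right]
    _ ≤ ε / 2 + ε / 2 := (norm_sub_le _ _).trans (add_le_add hn0 hA0)
    _ = ε := add_halves ε

theorem exists_pos_abs_setIntegral_le {f : ℝ → ℝ} {S : Set ℝ} (hf : IntegrableOn f S) {ε : ℝ}
    (hε : 0 < ε) : ∃ η > 0, ∀ G ⊆ S, MeasurableSet G → volume G ≤ ENNReal.ofReal η →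
      |∫ t in G, f t| ≤ ε := by
  obtain ⟨δ, hδ, hδs⟩ := exists_pos_setLIntegral_lt_of_measure_lt
    (μ := volume.restrict S) (f := fun t => ‖f t‖ₑ) hf.2.ne (ENNReal.ofReal_pos.2 hε).ne'
  obtain ⟨η, hη, hηδ⟩ : ∃ η : ℝ, 0 < η ∧ ENNReal.ofReal η < δ := by
    obtain ⟨r, hr, hrδ⟩ := ENNReal.lt_iff_exists_nnreal_btwn.1 hδ
    exact ⟨r, by exact_mod_cast hr, by simpa using hrδ⟩
  refine ⟨η, hη, fun G hG hGm hGv => ?_⟩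
  have h1 := hδs G (((Measure.restrict_apply_le _ _).trans hGv).trans_lt hηδ)
  rw [Measure.restrict_restrict hGm, inter_eq_self_of_subset_left hG] at h1
  rw [← Real.norm_eq_abs]
  refine (norm_integral_le_lintegral_norm _).trans ?_
  refine ENNReal.toReal_le_of_le_ofReal hε.le (le_of_eq_of_le ?_ h1.le)
  simp only [ofReal_norm]

theorem PettisIntegrable.exists_setIntegral_le {Γ : ℝ → Set X}
    (hP : PettisIntegrable Γ) {E : ℕ → Set ℝ}
    (hE : ∀ n, E n ⊆ Icc 0 1) (hEm : ∀ n, MeasurableSet (E n)) (hd : Pairwise (Function.onFun Disjoint E))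
    {b : ℕ → X →L[ℝ] ℝ} (hb : ∀ n, ‖b n‖ ≤ 1) {c : ℝ} (hc : 0 < c) :
    ∃ n, ∫ t in E n, suppFn (b n) (Γ t) ≤ c := by
  choose W hW hWs using fun n => hP.2 (E n) (hE n) (hEm n).nullMeasurableSet
  choose z hz hzb using fun n => (hW n).exists_eq_suppFn (b n)
  have hzle : ∀ n (x' : X →L[ℝ] ℝ), x' (z n) ≤ ∫ t in E n, suppFn x' (Γ t) := fun n x' =>
    (le_suppFn (hW n).isBounded x' (hz n)).trans_eq (hWs n x')
  have hsum : ∀ x' : X →L[ℝ] ℝ, Summable fun n => x' (z n) := fun x' => by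
    have h1 : ∀ y' : X →L[ℝ] ℝ, Summable fun n => ‖∫ t in E n, suppFn y' (Γ t)‖ := fun y' =>
      (hasSum_integral_iUnion hEm hd ((hP.1 y').mono_set (iUnion_subset hE))).summable.norm
    refine Summable.of_norm_bounded ((h1 x').add (h1 (-x'))) fun n => ?_
    have h2 := hzle n x'
    have h3 := hzle n (-x')
    rw [neg_apply] at h3
    rw [Real.norm_eq_abs, abs_le]
    have h4 := Real.le_norm_self (∫ t in E n, suppFn x' (Γ t))
    have h5 := Real.le_norm_self (∫ t in E n, suppFn (-x') (Γ t))
    have h6 := norm_nonneg (∫ t in E n, suppFn x' (Γ t))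
    have h7 := norm_nonneg (∫ t in E n, suppFn (-x') (Γ t))
    constructor <;> linarith
  have hsumA : ∀ (A : ℕ → Bool) (x' : X →L[ℝ] ℝ),
      Summable fun n => if A n then x' (z n) else 0 := fun A x' =>
    Summable.of_norm_bounded (hsum x').norm fun n => by
      split_ifs
      · exact le_rfl
      · simp
  have hψ : ∀ A : ℕ → Bool, ∃ x : X, ∀ x' : X →L[ℝ] ℝ,
      HasSum (fun n => if A n then x' (z n) else 0) (x' x) := fun A => by
    set S : ℕ → Set ℝ := fun n => if A n then E n else ∅ with hS
    have hSE : ∀ n, S n ⊆ E n := fun n => by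
      simp only [hS]
      split_ifs
      · exact Subset.rfl
      · exact empty_subset _
    have hSm : ∀ n, MeasurableSet (S n) := fun n => by
      simp only [hS]
      split_ifs
      · exact hEm n
      · exact MeasurableSet.empty
    have hSd : Pairwise (Function.onFun Disjoint S) := fun m n hmn => (hd hmn).mono (hSE m) (hSE n)
    have hSI : ⋃ n, S n ⊆ Icc (0 : ℝ) 1 := iUnion_subset fun n => (hSE n).trans (hE n)
    obtain ⟨V, hV, hVs⟩ := hP.2 _ hSI (MeasurableSet.iUnion hSm).nullMeasurableSet
    let l : (X →L[ℝ] ℝ) →ₗ[ℝ] ℝ :=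
      { toFun := fun x' => ∑' n, if A n then x' (z n) else 0
        map_add' := fun x' y' => by
          rw [← (hsumA A x').tsum_add (hsumA A y')]
          refine tsum_congr fun n => ?_
          split_ifs <;> simp
        map_smul' := fun a x' => by
          rw [RingHom.id_apply, smul_eq_mul, ← tsum_mul_left]
          refine tsum_congr fun n => ?_
          split_ifs <;> simp }
    obtain ⟨x, -, hx⟩ := hV.exists_eq_of_le l fun x' => by
      rw [hVs]
      have h1 := hasSum_integral_iUnion hSm hSd ((hP.1 x').mono_set hSI)
      refine hasSum_le (fun n => ?_) (hsumA A x').hasSum h1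
      by_cases hA : A n
      · simpa [hS, hA] using hzle n x'
      · simp [hS, hA]
    exact ⟨x, fun x' => hx x' ▸ (hsumA A x').hasSum⟩
  choose ψ hψ using hψ
  obtain ⟨n, hn⟩ := exists_norm_le_of_hasSum_weak hψ hc
  refine ⟨n, ?_⟩
  rw [← hWs, ← hzb]
  exact (Real.le_norm_self _).trans (((b n).le_opNorm _).trans
    ((mul_le_of_le_one_left (norm_nonneg _) (hb n)).trans hn))

/-- The scalar integrals of a Pettis integrable multifunction are uniformly integrable. -/
theorem PettisIntegrable.ui {Γ : ℝ → Set X}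
    (hΓ : ∀ t ∈ Icc (0 : ℝ) 1, IsCWK X (Γ t)) (hP : PettisIntegrable Γ) :
    UI fun (b : {e : X →L[ℝ] ℝ // ‖e‖ ≤ 1}) t => suppFn b.1 (Γ t) := by
  refine ⟨fun b => hP.1 b.1, ?_⟩
  by_contra! hcon
  obtain ⟨ε, hε, hcon⟩ := hcon
  have hpos : ∀ η > 0, ∃ E ⊆ Icc (0 : ℝ) 1, MeasurableSet E ∧ volume E ≤ ENNReal.ofReal η ∧
      ∃ b : {e : X →L[ℝ] ℝ // ‖e‖ ≤ 1}, ε / 2 < ∫ t in E, suppFn b.1 (Γ t) := by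
    intro η hη
    obtain ⟨E, hEI, hEm, hEv, b, hb⟩ := hcon η hη
    obtain ⟨g, hgm, hg⟩ := (hP.1 b.1).aestronglyMeasurable
    have hgE : (fun t => suppFn b.1 (Γ t)) =ᵐ[volume.restrict E] g :=
      ae_restrict_of_ae_restrict_of_subset hEI hg
    have hpm : MeasurableSet {t | 0 ≤ g t} := measurableSet_le measurable_const hgm.measurable
    have hi : IntegrableOn (fun t => |suppFn b.1 (Γ t)|) E := ((hP.1 b.1).mono_set hEI).abs
    have hsplit := integral_inter_add_sdiff hpm hi
    rw [← hsplit] at hb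
    rcases lt_or_ge (ε / 2) (∫ t in E ∩ {t | 0 ≤ g t}, |suppFn b.1 (Γ t)|) with h1 | h1
    · refine ⟨_, inter_subset_left.trans hEI, hEm.inter hpm,
        (measure_mono inter_subset_left).trans hEv, b, h1.trans_eq ?_⟩
      refine integral_congr_ae ?_
      filter_upwards [ae_restrict_of_ae_restrict_of_subset inter_subset_left hgE,
        ae_restrict_mem (hEm.inter hpm)] with t ht ht'
      have : 0 ≤ g t := ht'.2
      rw [abs_of_nonneg (ht ▸ this)]
    · have h2 : ε / 2 < ∫ t in E \ {t | 0 ≤ g t}, |suppFn b.1 (Γ t)| := by linarith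
      refine ⟨_, sdiff_subset.trans hEI, hEm.diff hpm,
        (measure_mono sdiff_subset).trans hEv, ⟨-b.1, (norm_neg _).trans_le b.2⟩, h2.trans_le ?_⟩
      refine integral_mono_ae (hi.mono_set sdiff_subset)
        ((hP.1 (-b.1)).mono_set (sdiff_subset.trans hEI)) ?_
      filter_upwards [ae_restrict_of_ae_restrict_of_subset sdiff_subset hgE,
        ae_restrict_mem (hEm.diff hpm)] with t ht ht'
      have h3 : g t < 0 := not_le.1 ht'.2
      have h4 := hΓ t (hEI ht'.1)
      obtain ⟨x, hx⟩ := h4.1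
      have h5 := neg_suppFn_neg_le h4.isBounded b.1 hx
      have h6 := le_suppFn h4.isBounded b.1 hx
      rw [← ht] at h3
      rw [abs_of_neg h3]
      linarith
  have : Nonempty {e : X →L[ℝ] ℝ // ‖e‖ ≤ 1} := ⟨⟨0, by simp⟩⟩
  choose! E hEI hEm hEv b hb using hpos
  have habs : ∀ η > 0, ∃ η' > 0, η' ≤ η ∧ ∀ G ⊆ Icc (0 : ℝ) 1, MeasurableSet G →
      volume G ≤ ENNReal.ofReal η' → |∫ t in G, suppFn (b η).1 (Γ t)| ≤ ε / 4 := fun η hη => by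
    obtain ⟨η', hη', h⟩ := exists_pos_abs_setIntegral_le (hP.1 (b η).1) (show 0 < ε / 4 by positivity)
    exact ⟨min η' η, lt_min hη' hη, min_le_right _ _, fun G hG hGm hGv =>
      h G hG hGm (hGv.trans (ENNReal.ofReal_le_ofReal (min_le_left _ _)))⟩
  choose! N hN hNle hNG using habs
  let η : ℕ → ℝ := fun n => Nat.rec 1 (fun _ r => N r / 2) n
  have hη : ∀ n, 0 < η n := fun n => by
    induction n with
    | zero => exact one_pos
    | succ n ih => exact half_pos (hN _ ih)
  have hηs : ∀ n, η (n + 1) = N (η n) / 2 := fun n => rfl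
  have hηle : ∀ n k, η (n + 1 + k) ≤ N (η n) / 2 / 2 ^ k := fun n k => by
    induction k with
    | zero => simp [hηs]
    | succ k ih =>
      rw [← add_assoc, hηs]
      calc N (η (n + 1 + k)) / 2 ≤ η (n + 1 + k) / 2 := by
            have := hNle _ (hη (n + 1 + k)); linarith
        _ ≤ N (η n) / 2 / 2 ^ k / 2 := by linarith
        _ = _ := by rw [pow_succ, div_div _ _ (2 : ℝ)]
  set U : ℕ → Set ℝ := fun n => ⋃ k, E (η (n + 1 + k)) with hU
  have hUm : ∀ n, MeasurableSet (U n) := fun n => MeasurableSet.iUnion fun k => hEm _ (hη _)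
  have hUv : ∀ n, volume (U n) ≤ ENNReal.ofReal (N (η n)) := fun n => by
    have hs : HasSum (fun k => N (η n) / 2 / 2 ^ k) (N (η n)) := hasSum_geometric_two' _
    calc volume (U n) ≤ ∑' k, volume (E (η (n + 1 + k))) := measure_iUnion_le _
      _ ≤ ∑' k, ENNReal.ofReal (N (η n) / 2 / 2 ^ k) :=
        ENNReal.tsum_le_tsum fun k => (hEv _ (hη _)).trans (ENNReal.ofReal_le_ofReal (hηle n k))
      _ = ENNReal.ofReal (N (η n)) := by
        rw [← ENNReal.ofReal_tsum_of_nonneg (fun k => ?_) hs.summable, hs.tsum_eq]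
        have := hN _ (hη n)
        positivity
  set D : ℕ → Set ℝ := fun n => E (η n) \ U n with hD
  have hdisj : ∀ m n, m < n → Disjoint (D m) (D n) := fun m n hmn => by
    refine disjoint_left.2 fun t htm htn => htm.2 (mem_iUnion.2 ⟨n - (m + 1), ?_⟩)
    rw [Nat.add_sub_cancel' hmn]
    exact htn.1
  obtain ⟨n, hn⟩ := PettisIntegrable.exists_setIntegral_le hP (E := D) (b := fun n => (b (η n)).1)
    (fun n => sdiff_subset.trans (hEI _ (hη n))) (fun n => (hEm _ (hη n)).diff (hUm n))
    (fun m n hmn => (lt_or_gt_of_ne hmn).elim (hdisj m n) fun h => (hdisj n m h).symm)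
    (fun n => (b (η n)).2) (show 0 < ε / 4 by positivity)
  have h1 := integral_inter_add_sdiff (hUm n) ((hP.1 (b (η n)).1).mono_set (hEI _ (hη n)))
  have h2 := hNG _ (hη n) (E (η n) ∩ U n) (inter_subset_left.trans (hEI _ (hη n)))
    ((hEm _ (hη n)).inter (hUm n)) ((measure_mono inter_subset_right).trans (hUv n))
  have h3 := hb _ (hη n)
  rw [← h1] at h3
  have h4 := (abs_le.1 h2).2
  simp only [hD] at hn
  linarith

/-- Pettis' measurability theorem. -/
theorem aestronglyMeasurable_of_weak [CompleteSpace X] {μ : Measure ℝ} {f : ℝ → X} {s : Set X}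
    (hs : TopologicalSpace.IsSeparable s)
    (hfs : ∀ᵐ t ∂μ, f t ∈ closure (Submodule.span ℝ s : Set X))
    (hw : ∀ x' : X →L[ℝ] ℝ, AEMeasurable (fun t => x' (f t)) μ) : AEStronglyMeasurable f μ := by
  set V : Submodule ℝ X := (Submodule.span ℝ s).topologicalClosure with hV
  have hVsep : TopologicalSpace.SeparableSpace V :=
    (hs.span (R := ℝ)).closure.separableSpace
  have hVcomp : CompleteSpace V :=
    (Submodule.isClosed_topologicalClosure _).isComplete.completeSpace_coe
  have : SecondCountableTopology V := UniformSpace.secondCountable_of_separable V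
  have hpol : PolishSpace V := inferInstance
  borelize (V : Type _)
  choose e he using fun n => exists_dual_norm_le_one (TopologicalSpace.denseSeq V n : X)
  have hinj : Function.Injective fun (x : V) (n : ℕ) => (e n).1 (x : X) := by
    refine fun x y hxy => ?_
    rw [← sub_eq_zero, ← norm_le_zero_iff]
    refine le_of_forall_pos_le_add fun ε hε => ?_
    obtain ⟨n, hn⟩ := Metric.denseRange_iff.1 (TopologicalSpace.denseRange_denseSeq V) (x - y) (ε / 2)
      (half_pos hε)
    set d := TopologicalSpace.denseSeq V n with hd
    rw [dist_eq_norm] at hn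
    have h1 : (e n).1 ((x - y : V) : X) = 0 := by
      rw [Submodule.coe_sub, map_sub, sub_eq_zero]
      exact congrFun hxy n
    have h2 : ‖d‖ ≤ ‖x - y - d‖ := by
      calc ‖d‖ = (e n).1 (d : X) := (he n).symm
        _ = -(e n).1 ((x - y - d : V) : X) := by
          rw [show ((x - y - d : V) : X) = ((x - y : V) : X) - d from rfl, map_sub, h1, zero_sub, neg_neg]
        _ ≤ ‖(e n).1 ((x - y - d : V) : X)‖ := by
          rw [← norm_neg]; exact Real.le_norm_self _
        _ ≤ _ := ((e n).1.le_opNorm _).trans (mul_le_of_le_one_left (norm_nonneg _) (e n).2)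
    have h3 := norm_le_norm_add_norm_sub' (x - y) d
    linarith
  have hemb : MeasurableEmbedding fun (x : V) (n : ℕ) => (e n).1 (x : X) :=
    Continuous.measurableEmbedding
      (continuous_pi fun n => (e n).1.continuous.comp continuous_subtype_val) hinj
  classical
  set g : ℝ → V := fun t => if h : f t ∈ V then ⟨f t, h⟩ else 0 with hg
  have hfg : f =ᵐ[μ] fun t => (g t : X) := by
    filter_upwards [hfs] with t ht
    have : f t ∈ V := ht
    simp [hg, this]
  have hgm : AEMeasurable g μ := by
    refine hemb.aemeasurable_comp_iff.1 (aemeasurable_pi_lambda _ fun n => ?_)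
    refine (hw (e n).1).congr ?_
    filter_upwards [hfg] with t ht
    simp only [Function.comp, ← ht]
  exact (continuous_subtype_val.comp_aestronglyMeasurable hgm.aestronglyMeasurable).congr hfg.symm

theorem integral_le_sub_of_monotoneOn {D k : ℝ → ℝ} {a b : ℝ} (hab : a ≤ b)
    (hD : MonotoneOn D (Icc a b)) (hk : IntervalIntegrable k volume a b)
    (h : ∀ᵐ t, t ∈ Ioo a b → k t ≤ deriv D t) : ∫ t in a..b, k t ≤ D b - D a := by
  rw [← uIcc_of_le hab] at hD
  have h1 := MonotoneOn.intervalIntegral_deriv_mem_uIcc hD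
  have h2 : D a ≤ D b := hD left_mem_uIcc right_mem_uIcc hab
  rw [uIcc_of_le (sub_nonneg.2 h2)] at h1
  refine le_trans ?_ h1.2
  refine intervalIntegral.integral_mono_ae_restrict hab hk
    (MonotoneOn.intervalIntegrable_deriv hD) ?_
  rw [← restrict_Ioo_eq_restrict_Icc]
  exact (ae_restrict_iff' measurableSet_Ioo).2 h

theorem vHPrimitive.fvHPrimitive_emb {Γ : ℝ → Set X} {Φ : ℝ → ℝ → Set X} (h : vHPrimitive Γ Φ)
    (hΓ : ∀ t ∈ Icc (0 : ℝ) 1, IsCWK X (Γ t)) :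
    FvHPrimitive (fun t => emb (Γ t)) fun a b => emb (Φ a b) := by
  refine ⟨fun a b c h0 hab hbc h1 => ?_, fun ε hε => ?_⟩
  · dsimp only
    rw [h.2.1 a b c h0 hab hbc h1]
    exact (h.1 a b h0 hab (hbc.trans h1)).bddConv.emb_add
      (h.1 b c (h0.trans hab) hbc h1).bddConv
  · obtain ⟨δ, hδ, hδs⟩ := h.2.2 ε hε
    refine ⟨δ, hδ, fun n P hP hPδ => lt_of_eq_of_lt ?_ (hδs n P hP hPδ)⟩
    refine Finset.sum_congr rfl fun i _ => ?_
    have hg := (hΓ _ (P.tagMem i)).bddConv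
    rw [(h.1 _ _ (P.pt_nonneg _) (P.pt_le i) (P.pt_le_one _)).bddConv.hausdorffDist_eq
      (hg.smul _), hg.emb_smul (c := P.len i) (sub_nonneg.2 (P.pt_le i))]

theorem BddConv.apply_le_norm {A : Set X} (hA : BddConv A) {x : X} (hx : x ∈ A)
    (e : {e : X →L[ℝ] ℝ // ‖e‖ ≤ 1}) : e.1 x ≤ (emb A : SuppSpace X) e :=
  (le_suppFn hA.2.2 _ hx).trans_eq (hA.emb_apply e).symm

theorem BddConv.norm_le {A : Set X} (hA : BddConv A) {x : X} (hx : x ∈ A) : ‖x‖ ≤ ‖emb A‖ := by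
  obtain ⟨e, he⟩ := exists_dual_norm_le_one x
  rw [← he]
  exact (hA.apply_le_norm hx e).trans ((Real.le_norm_self _).trans
    (lp.norm_apply_le_norm (by simp) _ _))

/-- Weak cluster values of the difference quotients of a selection of `Φ` at a point where the
embedded primitive is differentiable. -/
theorem exists_weak_deriv {Φ : ℝ → ℝ → Set X} {F : ℝ → X} {Q : ℝ → SuppSpace X} {A : Set X}
    (hΦ : ∀ a b : ℝ, 0 ≤ a → a ≤ b → b ≤ 1 → IsCWK X (Φ a b))
    (hQ : ∀ a b : ℝ, 0 ≤ a → a ≤ b → b ≤ 1 → Q b - Q a = emb (Φ a b))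
    (hF : ∀ a b : ℝ, 0 ≤ a → a ≤ b → b ≤ 1 → F b - F a ∈ Φ a b) (hA : IsCWK X A) {t : ℝ}
    (ht : t ∈ Ioo (0 : ℝ) 1) (hd : HasDerivAt Q (emb A) t) :
    ∃ y ∈ A, ∀ (x' : X →L[ℝ] ℝ) (d : ℝ), HasDerivAt (fun s => x' (F s)) d t → x' y = d := by
  set h : ℕ → ℝ := fun n => 1 / ((n : ℝ) + 1) with hh
  have hpos : ∀ n, 0 < h n := fun n => by positivity
  have hlim : Tendsto h atTop (𝓝 0) := tendsto_one_div_add_atTop_nhds_zero_nat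
  have hlim' : Tendsto h atTop (𝓝[≠] 0) :=
    tendsto_nhdsWithin_iff.2 ⟨hlim, Eventually.of_forall fun n => (hpos n).ne'⟩
  set q : ℕ → X := fun n => (h n)⁻¹ • (F (t + h n) - F t) with hq
  have hQlim := hd.tendsto_slope_zero.comp hlim'
  have hinf : Tendsto (fun n => infDist (q n) A) atTop (𝓝 0) := by
    have h1 := tendsto_iff_norm_sub_tendsto_zero.1 hQlim
    refine squeeze_zero' (Eventually.of_forall fun _ => infDist_nonneg) ?_ h1
    have h2 : ∀ᶠ n in atTop, h n < 1 - t := hlim.eventually_lt_const (by linarith [ht.2])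
    filter_upwards [h2] with n hn
    have h3 : 0 ≤ t := ht.1.le
    have h4 : t ≤ t + h n := by linarith [hpos n]
    have h5 : t + h n ≤ 1 := by linarith
    have h6 := (hΦ _ _ h3 h4 h5).bddConv
    have h7 := (h6.smul (h n)⁻¹).infDist_le hA.bddConv
      (smul_mem_smul_set (hF _ _ h3 h4 h5))
    rwa [h6.emb_smul (inv_nonneg.2 (hpos n).le), ← hQ _ _ h3 h4 h5] at h7
  have hw : ∀ n, ∃ w ∈ A, dist (q n) w < infDist (q n) A + h n := fun n =>
    (infDist_lt_iff hA.1).1 (lt_add_of_pos_right _ (hpos n))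
  choose w hwA hwd using hw
  have hqw : Tendsto (fun n => q n - w n) atTop (𝓝 0) := by
    refine squeeze_zero_norm (fun n => ?_) (by simpa using hinf.add hlim)
    rw [← dist_eq_norm]
    exact (hwd n).le
  set 𝒰 : Ultrafilter ℕ := hyperfilter ℕ
  have h𝒰 : (𝒰 : Filter ℕ) ≤ atTop := Nat.hyperfilter_le_atTop
  obtain ⟨_, ⟨y, hy, rfl⟩, hyl⟩ := hA.2.2.ultrafilter_le_nhds (𝒰.map fun n => toWeakSpace ℝ X (w n))
    (by
      refine le_principal_iff.2 (Filter.mem_map.2 (Eventually.of_forall fun n => ?_))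
      exact mem_image_of_mem _ (hwA n))
  refine ⟨y, hy, fun x' d hx' => ?_⟩
  have h1 : Tendsto (fun n => x' (w n)) 𝒰 (𝓝 (x' y)) := by
    have hc : Continuous fun y : WeakSpace ℝ X => x' ((toWeakSpace ℝ X).symm y) :=
      WeakBilin.eval_continuous _ x'
    exact (hc.tendsto (toWeakSpace ℝ X y)).comp hyl
  have h2 : Tendsto (fun n => x' (q n)) 𝒰 (𝓝 d) := by
    refine ((hx'.tendsto_slope_zero.comp hlim').mono_left h𝒰).congr fun n => ?_
    simp only [Function.comp, hq, map_smul, map_sub]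
  have h3 : Tendsto (fun n => x' (q n - w n)) 𝒰 (𝓝 0) := by
    have := ((x'.continuous.tendsto 0).comp hqw).mono_left h𝒰
    rwa [map_zero] at this
  have h4 := h3.add h1
  simp only [map_sub, sub_add_cancel, zero_add] at h4
  exact tendsto_nhds_unique h4 h2

/-- A selection of the primitive is differentiable a.e. on a set where the scalar derivatives and
the derivative of the embedded primitive are bounded. -/
theorem ae_hasDerivAt_of_norm_le [CompleteSpace X] {G Q : ℝ → SuppSpace X} {f F : ℝ → X}
    (hG : StronglyMeasurable G) (hf : StronglyMeasurable f)
    (hQ : ∀ᵐ t, t ∈ Ioo (0 : ℝ) 1 → HasDerivAt Q (G t) t)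
    (hF : ∀ e : {e : X →L[ℝ] ℝ // ‖e‖ ≤ 1}, ∀ᵐ t, t ∈ Ioo (0 : ℝ) 1 →
      HasDerivAt (fun s => e.1 (F s)) (e.1 (f t)) t)
    (hmono : ∀ e, MonotoneOn (fun s => Q s e - e.1 (F s)) (Icc 0 1)) (M : ℝ) :
    ∀ᵐ t, t ∈ Ioo (0 : ℝ) 1 → ‖f t‖ ≤ M → ‖G t‖ ≤ M → HasDerivAt F (f t) t := by
  set A : Set ℝ := Icc 0 1 ∩ ({t | ‖f t‖ ≤ M} ∩ {t | ‖G t‖ ≤ M}) with hAdef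
  have hAm : MeasurableSet A := measurableSet_Icc.inter
    ((hf.norm.measurableSet_le stronglyMeasurable_const).inter
      (hG.norm.measurableSet_le stronglyMeasurable_const))
  have hAfin : volume A ≠ ∞ :=
    ((measure_mono inter_subset_left).trans_lt isCompact_Icc.measure_lt_top).ne
  have hu1 : Integrable (A.indicator f) := by
    rw [integrable_indicator_iff hAm]
    exact Measure.integrableOn_of_bounded hAfin hf.aestronglyMeasurable (M := M)
      ((ae_restrict_iff' hAm).2 (Eventually.of_forall fun t ht => ht.2.1))
  have hu2 : Integrable (A.indicator G) := by
    rw [integrable_indicator_iff hAm]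
    exact Measure.integrableOn_of_bounded hAfin hG.aestronglyMeasurable (M := M)
      ((ae_restrict_iff' hAm).2 (Eventually.of_forall fun t ht => ht.2.2))
  set R : ℝ → X := fun x => F x - ∫ s in (0 : ℝ)..x, A.indicator f s with hR
  set T : ℝ → SuppSpace X := fun x => Q x - ∫ s in (0 : ℝ)..x, A.indicator G s with hT
  have hRT : ∀ a b : ℝ, 0 ≤ a → a ≤ b → b ≤ 1 → ‖R b - R a‖ ≤ ‖T b - T a‖ := by
    intro a b h0 hab h1
    obtain ⟨e, he⟩ := exists_dual_norm_le_one (R b - R a)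
    set L : SuppSpace X →L[ℝ] ℝ :=
      lp.evalCLM ℝ (fun _ : {e : X →L[ℝ] ℝ // ‖e‖ ≤ 1} => ℝ) ∞ e with hL
    have hLe : ∀ v : SuppSpace X, L v = v e := fun v => rfl
    refine le_trans ?_ ((Real.le_norm_self _).trans
      (lp.norm_apply_le_norm (by simp) (T b - T a) e))
    rw [← he, ← hLe]
    have hi1 : IntervalIntegrable (A.indicator f) volume a b := hu1.intervalIntegrable
    have hi2 : IntervalIntegrable (A.indicator G) volume a b := hu2.intervalIntegrable
    have hR' : R b - R a = F b - F a - ∫ s in a..b, A.indicator f s := by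
      rw [← intervalIntegral.integral_interval_sub_left (a := 0) hu1.intervalIntegrable
        hu1.intervalIntegrable]
      simp only [hR]
      abel
    have hT' : T b - T a = Q b - Q a - ∫ s in a..b, A.indicator G s := by
      rw [← intervalIntegral.integral_interval_sub_left (a := 0) hu2.intervalIntegrable
        hu2.intervalIntegrable]
      simp only [hT]
      abel
    have hk1 : IntervalIntegrable (fun t => L (A.indicator G t)) volume a b :=
      (L.integrable_comp hu2).intervalIntegrable
    have hk2 : IntervalIntegrable (fun t => e.1 (A.indicator f t)) volume a b :=
      (e.1.integrable_comp hu1).intervalIntegrable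
    have hkey := integral_le_sub_of_monotoneOn hab
      ((hmono e).mono (Icc_subset_Icc h0 h1)) (hk1.sub hk2) (by
        filter_upwards [hQ, hF e] with t h2 h3 ht
        have ht' : t ∈ Ioo (0 : ℝ) 1 := ⟨h0.trans_lt ht.1, ht.2.trans_le h1⟩
        have h4 : HasDerivAt (fun s => Q s e - e.1 (F s)) (L (G t) - e.1 (f t)) t :=
          (L.hasFDerivAt.comp_hasDerivAt t (h2 ht')).sub (h3 ht')
        by_cases htA : t ∈ A
        · simp only [indicator_of_mem htA, h4.deriv, le_refl]
        · simp only [indicator_of_notMem htA, map_zero, sub_zero]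
          rw [← derivWithin_of_mem_nhds (Icc_mem_nhds ht'.1 ht'.2)]
          exact (hmono e).derivWithin_nonneg)
    rw [intervalIntegral.integral_sub hk1 hk2, L.intervalIntegral_comp_comm hi2,
      e.1.intervalIntegral_comp_comm hi1] at hkey
    rw [hR', hT', map_sub, map_sub, map_sub, map_sub, hLe (Q b), hLe (Q a)]
    linarith
  have hRT' : ∀ a ∈ Icc (0 : ℝ) 1, ∀ b ∈ Icc (0 : ℝ) 1, ‖R b - R a‖ ≤ ‖T b - T a‖ := by
    intro a ha b hb
    rcases le_total a b with hab | hab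
    · exact hRT a b ha.1 hab hb.2
    · rw [norm_sub_rev, norm_sub_rev (T b)]
      exact hRT b a hb.1 hab ha.2
  filter_upwards [LocallyIntegrable.ae_hasDerivAt_integral hu1.locallyIntegrable,
    LocallyIntegrable.ae_hasDerivAt_integral hu2.locallyIntegrable, hQ] with t h1 h2 h3 ht htf htG
  have htA : t ∈ A := ⟨Ioo_subset_Icc_self ht, htf, htG⟩
  have h1' := h1 0
  have h2' := h2 0
  rw [indicator_of_mem htA] at h1' h2'
  have hTd : HasDerivAt T 0 t := by
    have := (h3 ht).sub h2'
    rwa [sub_self] at this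
  have hRd : HasDerivAt R 0 t := by
    rw [hasDerivAt_iff_isLittleO] at hTd ⊢
    refine Asymptotics.IsBigO.trans_isLittleO (Asymptotics.IsBigO.of_bound 1 ?_) hTd
    filter_upwards [Icc_mem_nhds ht.1 ht.2] with x hx
    rw [one_mul, smul_zero, smul_zero, sub_zero, sub_zero]
    exact hRT' t (Ioo_subset_Icc_self ht) x hx
  have := hRd.add h1'
  rw [zero_add] at this
  refine this.congr_of_eventuallyEq (Eventually.of_forall fun x => ?_)
  simp [hR]

theorem ae_hasDerivAt_of_weak [CompleteSpace X] {G Q : ℝ → SuppSpace X} {f F : ℝ → X}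
    (hG : AEStronglyMeasurable G (volume.restrict (Icc 0 1)))
    (hf : AEStronglyMeasurable f (volume.restrict (Icc 0 1)))
    (hQ : ∀ᵐ t, t ∈ Ioo (0 : ℝ) 1 → HasDerivAt Q (G t) t)
    (hF : ∀ e : {e : X →L[ℝ] ℝ // ‖e‖ ≤ 1}, ∀ᵐ t, t ∈ Ioo (0 : ℝ) 1 →
      HasDerivAt (fun s => e.1 (F s)) (e.1 (f t)) t)
    (hmono : ∀ e, MonotoneOn (fun s => Q s e - e.1 (F s)) (Icc 0 1)) :
    ∀ᵐ t, t ∈ Ioo (0 : ℝ) 1 → HasDerivAt F (f t) t := by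
  have hGG := (ae_restrict_iff' measurableSet_Icc).1 hG.ae_eq_mk
  have hff := (ae_restrict_iff' measurableSet_Icc).1 hf.ae_eq_mk
  have key := fun n : ℕ => ae_hasDerivAt_of_norm_le hG.stronglyMeasurable_mk
    hf.stronglyMeasurable_mk (by
      filter_upwards [hQ, hGG] with t h1 h2 ht
      rw [← h2 (Ioo_subset_Icc_self ht)]
      exact h1 ht) (fun e => by
      filter_upwards [hF e, hff] with t h1 h2 ht
      rw [← h2 (Ioo_subset_Icc_self ht)]
      exact h1 ht) hmono n
  filter_upwards [ae_all_iff.2 key, hff] with t h1 h2 ht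
  obtain ⟨n, hn⟩ := exists_nat_ge (max ‖hf.mk f t‖ ‖hG.mk G t‖)
  rw [h2 (Ioo_subset_Icc_self ht)]
  exact h1 n ht ((le_max_left _ _).trans hn) ((le_max_right _ _).trans hn)

/-- A variationally Henstock integrable multifunction has a variationally Henstock integrable
selection. -/
theorem vHPrimitive.exists_selection [CompleteSpace X] {Γ : ℝ → Set X} {Φ : ℝ → ℝ → Set X}
    (hΦ : vHPrimitive Γ Φ) (hΓ : ∀ t ∈ Icc (0 : ℝ) 1, IsCWK X (Γ t)) :
    ∃ f F, Selection Γ f ∧ VH f F := by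
  have hemb := hΦ.fvHPrimitive_emb hΓ
  set Q : ℝ → SuppSpace X := fun b => emb (Φ 0 b) with hQdef
  have hQVH : VH (fun t => emb (Γ t)) Q := hemb.vh
  have hQ : ∀ a b : ℝ, 0 ≤ a → a ≤ b → b ≤ 1 → Q b - Q a = emb (Φ a b) := fun a b h0 hab h1 =>
    (hemb.sub_eq h0 hab h1).symm
  have hQd := hQVH.ae_hasDerivAt
  obtain ⟨F, hF⟩ := exists_additive_selection hΦ.1 hΦ.2.1
  have hFQ : ∀ a b : ℝ, 0 ≤ a → a ≤ b → b ≤ 1 → ‖F b - F a‖ ≤ ‖Q b - Q a‖ :=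
    fun a b h0 hab h1 => by
      rw [hQ a b h0 hab h1]
      exact (hΦ.1 a b h0 hab h1).bddConv.norm_le (hF a b h0 hab h1)
  have hsel : ∀ t, ∃ y, (t ∈ Icc (0 : ℝ) 1 → y ∈ Γ t) ∧
      (t ∈ Ioo (0 : ℝ) 1 → HasDerivAt Q (emb (Γ t)) t →
        ∀ (x' : X →L[ℝ] ℝ) (d : ℝ), HasDerivAt (fun s => x' (F s)) d t → x' y = d) := by
    intro t
    by_cases ht : t ∈ Icc (0 : ℝ) 1
    · by_cases h : t ∈ Ioo (0 : ℝ) 1 ∧ HasDerivAt Q (emb (Γ t)) t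
      · obtain ⟨y, hy, hy'⟩ := exists_weak_deriv hΦ.1 hQ hF (hΓ t ht) h.1 h.2
        exact ⟨y, fun _ => hy, fun _ _ => hy'⟩
      · obtain ⟨y, hy⟩ := (hΓ t ht).1
        exact ⟨y, fun _ => hy, fun h1 h2 => absurd ⟨h1, h2⟩ h⟩
    · exact ⟨0, fun h => absurd h ht, fun h => absurd (Ioo_subset_Icc_self h) ht⟩
  choose f hfΓ hfd using hsel
  have hmono : ∀ x' : X →L[ℝ] ℝ, MonotoneOn (fun s => evalAt x' (Q s) - x' (F s)) (Icc 0 1) := by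
    intro x' a ha b hb hab
    have h1 := hΦ.1 a b ha.1 hab hb.2
    have h2 := le_suppFn h1.isBounded x' (hF a b ha.1 hab hb.2)
    rw [← h1.bddConv.evalAt_emb, ← hQ a b ha.1 hab hb.2, map_sub, map_sub] at h2
    dsimp only
    linarith
  have hder : ∀ x' : X →L[ℝ] ℝ, ∀ᵐ t, t ∈ Ioo (0 : ℝ) 1 →
      HasDerivAt (fun s => x' (F s)) (x' (f t)) t := by
    intro x'
    filter_upwards [hQd, MonotoneOn.ae_differentiableWithinAt_of_mem (hmono x')] with t h1 h2 ht
    have h3 := ((h2 (Ioo_subset_Icc_self ht)).differentiableAt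
      (Icc_mem_nhds ht.1 ht.2)).hasDerivAt
    have h4 := ((evalAt x').hasFDerivAt.comp_hasDerivAt t (h1 ht)).sub h3
    have h5 : HasDerivAt (fun s => x' (F s)) _ t :=
      h4.congr_of_eventuallyEq (Eventually.of_forall fun s => (sub_sub_cancel _ _).symm)
    rwa [hfd t ht (h1 ht) x' _ h5]
  have hFc : ContinuousOn F (Icc 0 1) := by
    intro a ha
    have h1 := tendsto_iff_norm_sub_tendsto_zero.1 (hQVH.continuousOn a ha)
    refine tendsto_iff_norm_sub_tendsto_zero.2 (squeeze_zero' (Eventually.of_forall fun _ =>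
      norm_nonneg _) ?_ h1)
    filter_upwards [self_mem_nhdsWithin] with b hb
    rcases le_total a b with hab | hab
    · exact hFQ a b ha.1 hab hb.2
    · rw [norm_sub_rev, norm_sub_rev (Q b)]
      exact hFQ b a hb.1 hab ha.2
  have hfm : AEStronglyMeasurable f (volume.restrict (Icc 0 1)) := by
    rw [← restrict_Ioo_eq_restrict_Icc]
    refine aestronglyMeasurable_of_weak (isCompact_Icc.image_of_continuousOn hFc).isSeparable
      ((ae_restrict_iff' measurableSet_Ioo).2 ?_) fun x' => ?_
    · filter_upwards [hQd] with t h1 ht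
      refine mem_closure_span_of_forall fun x' hx' => hfd t ht (h1 ht) x' 0 ?_
      refine (hasDerivAt_const t (0 : ℝ)).congr_of_eventuallyEq ?_
      filter_upwards [Icc_mem_nhds ht.1 ht.2] with s hs
      exact hx' _ (mem_image_of_mem _ hs)
    · refine (measurable_deriv fun s => x' (F s)).aemeasurable.congr ?_
      refine (ae_restrict_iff' measurableSet_Ioo).2 ?_
      filter_upwards [hder x'] with t h1 ht
      exact (h1 ht).deriv
  refine ⟨f, F, fun t ht => hfΓ t ht, hQVH.of_ae_hasDerivAt hFQ ?_⟩
  refine ae_hasDerivAt_of_weak hQVH.aestronglyMeasurable hfm hQd (fun e => hder e.1) ?_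
  intro e a ha b hb hab
  have h1 := (hΦ.1 a b ha.1 hab hb.2).bddConv.apply_le_norm (hF a b ha.1 hab hb.2) e
  rw [← hQ a b ha.1 hab hb.2, lp.coeFn_sub, Pi.sub_apply, map_sub] at h1
  dsimp only
  linarith

/-- The coordinate functionals of `SuppSpace X`. -/
noncomputable def coord (e : {e : X →L[ℝ] ℝ // ‖e‖ ≤ 1}) : SuppSpace X →L[ℝ] ℝ :=
  lp.evalCLM ℝ (fun _ : {e : X →L[ℝ] ℝ // ‖e‖ ≤ 1} => ℝ) ∞ e

theorem coord_apply (e : {e : X →L[ℝ] ℝ // ‖e‖ ≤ 1}) (v : SuppSpace X) : coord e v = v e := rfl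

theorem norm_coord_le (e : {e : X →L[ℝ] ℝ // ‖e‖ ≤ 1}) : ‖coord e‖ ≤ 1 :=
  ContinuousLinearMap.opNorm_le_bound _ zero_le_one fun v => by
    rw [one_mul]
    exact lp.norm_apply_le_norm (by simp) v e

theorem BddConv.abs_le_coord {A : Set X} (hA : BddConv A) {x : X} (hx : x ∈ A)
    (e : {e : X →L[ℝ] ℝ // ‖e‖ ≤ 1}) :
    |e.1 x| ≤ |coord e (emb A)| + |coord ⟨-e.1, (norm_neg e.1).trans_le e.2⟩ (emb A)| := by
  have h1 := le_suppFn hA.2.2 e.1 hx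
  have h2 := neg_suppFn_neg_le hA.2.2 e.1 hx
  rw [coord_apply, coord_apply, hA.emb_apply, hA.emb_apply, abs_le]
  dsimp only
  have h3 := le_abs_self (suppFn e.1 A)
  have h4 := le_abs_self (suppFn (-e.1) A)
  have h5 := abs_nonneg (suppFn e.1 A)
  have h6 := abs_nonneg (suppFn (-e.1) A)
  constructor <;> linarith

theorem UI.selection {Γ : ℝ → Set X} (hΓ : ∀ t ∈ Icc (0 : ℝ) 1, IsCWK X (Γ t))
    (hu : UI fun (e : {e : X →L[ℝ] ℝ // ‖e‖ ≤ 1}) t => coord e (emb (Γ t))) {f : ℝ → X}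
    (hf : Selection Γ f) (hfm : AEStronglyMeasurable f (volume.restrict (Icc 0 1))) :
    UI fun (e : {e : X →L[ℝ] ℝ // ‖e‖ ≤ 1}) t => e.1 (f t) :=
  hu.of_abs_le (fun e => e.1.continuous.comp_aestronglyMeasurable hfm)
    (p := fun e => e) (q := fun e => ⟨-e.1, (norm_neg e.1).trans_le e.2⟩)
    fun e t ht => (hΓ t ht).bddConv.abs_le_coord (hf t ht) e

theorem FvHIntegrable.aestronglyMeasurable {f : ℝ → X} (hf : FvHIntegrable f) :
    AEStronglyMeasurable f (volume.restrict (Icc 0 1)) :=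
  let ⟨_, hφ⟩ := hf
  hφ.vh.aestronglyMeasurable

theorem vHPrimitive.pettisIntegrable {Γ : ℝ → Set X} {Φ : ℝ → ℝ → Set X} (hΦ : vHPrimitive Γ Φ)
    (hΓ : ∀ t ∈ Icc (0 : ℝ) 1, IsCWK X (Γ t)) {f : ℝ → X} (hf : Selection Γ f)
    (hfP : FPettisIntegrable f) : PettisIntegrable Γ := by
  have hemb := hΦ.fvHPrimitive_emb hΓ
  have heq : ∀ x' : X →L[ℝ] ℝ, ∀ t ∈ Icc (0 : ℝ) 1, evalAt x' (emb (Γ t)) = suppFn x' (Γ t) :=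
    fun x' t ht => (hΓ t ht).bddConv.evalAt_emb x'
  have hle : ∀ x' : X →L[ℝ] ℝ, ∀ t ∈ Icc (0 : ℝ) 1, x' (f t) ≤ suppFn x' (Γ t) :=
    fun x' t ht => le_suppFn (hΓ t ht).isBounded x' (hf t ht)
  have hi : ∀ x' : X →L[ℝ] ℝ, IntegrableOn (fun t => evalAt x' (emb (Γ t))) (Icc 0 1) :=
    fun x' => (hemb.vh.clm (evalAt x')).integrableOn_of_le (hfP.1 x')
      (Eventually.of_forall fun t ht => by
        rw [heq x' t ht]
        exact hle x' t ht)
  have hi' : ∀ x' : X →L[ℝ] ℝ, IntegrableOn (fun t => suppFn x' (Γ t)) (Icc 0 1) :=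
    fun x' => (hi x').congr_fun (heq x') measurableSet_Icc
  have h01 := hΦ.1 0 1 le_rfl zero_le_one le_rfl
  have hint : ∀ x' : X →L[ℝ] ℝ, ∫ t in Icc (0 : ℝ) 1, suppFn x' (Γ t) = suppFn x' (Φ 0 1) := by
    intro x'
    rw [← setIntegral_congr_fun measurableSet_Icc (heq x'),
      (hemb.vh.clm (evalAt x')).setIntegral_eq (hi x'), ← map_sub,
      ← hemb.sub_eq le_rfl zero_le_one le_rfl, h01.bddConv.evalAt_emb]
  refine ⟨hi', fun E hE hEm => ?_⟩
  obtain ⟨w, hw⟩ := hfP.2 E hE hEm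
  obtain ⟨v, hv⟩ := hfP.2 (Icc 0 1) Subset.rfl measurableSet_Icc.nullMeasurableSet
  refine (h01.add_singleton (w - v)).exists_suppFn_eq (fun x' => ∫ t in E, suppFn x' (Γ t))
    (fun c hc x' => ?_) (fun x' y' => ?_) fun x' => ?_
  · simp only [suppFn_smul hc.le]
    exact integral_const_mul _ _
  · rw [← integral_add ((hi' x').mono_set hE) ((hi' y').mono_set hE)]
    refine setIntegral_mono_on₀ ((hi' _).mono_set hE)
      (((hi' x').mono_set hE).add ((hi' y').mono_set hE)) hEm fun t ht => ?_
    have hb := hΓ t (hE ht)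
    refine suppFn_le hb.1 fun x hx => ?_
    exact add_le_add (le_suppFn hb.isBounded x' hx) (le_suppFn hb.isBounded y' hx)
  · have h1 : ∫ t in E, (suppFn x' (Γ t) - x' (f t)) ≤
        ∫ t in Icc (0 : ℝ) 1, (suppFn x' (Γ t) - x' (f t)) :=
      setIntegral_mono_set ((hi' x').sub (hfP.1 x'))
        ((ae_restrict_iff' measurableSet_Icc).2
          (Eventually.of_forall fun t ht => sub_nonneg.2 (hle x' t ht))) hE.eventuallyLE
    rw [integral_sub ((hi' x').mono_set hE) ((hfP.1 x').mono_set hE),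
      integral_sub (hi' x') (hfP.1 x'), ← hw, ← hv, hint] at h1
    rw [suppFn_add h01.1 h01.isBounded (singleton_nonempty _) Bornology.isBounded_singleton]
    have h2 : suppFn x' {w - v} = x' w - x' v := by
      rw [suppFn, image_singleton, csSup_singleton, map_sub]
    rw [h2]
    linarith

theorem PettisIntegrable.ui_coord {Γ : ℝ → Set X} (hP : PettisIntegrable Γ)
    (hΓ : ∀ t ∈ Icc (0 : ℝ) 1, IsCWK X (Γ t))
    (hm : AEStronglyMeasurable (fun t => emb (Γ t)) (volume.restrict (Icc 0 1))) :
    UI fun (e : {e : X →L[ℝ] ℝ // ‖e‖ ≤ 1}) t => coord e (emb (Γ t)) :=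
  (PettisIntegrable.ui hΓ hP).of_abs_le
    (fun e => (coord e).continuous.comp_aestronglyMeasurable hm) (p := id) (q := id)
    fun e t ht => by
      rw [coord_apply, (hΓ t ht).bddConv.emb_apply]
      exact le_add_of_nonneg_right (abs_nonneg _)

theorem FvHIntegrable.fMcShaneIntegrable {f : ℝ → X} (hf : FvHIntegrable f)
    (hui : UI fun (e : {e : X →L[ℝ] ℝ // ‖e‖ ≤ 1}) t => e.1 (f t)) : FMcShaneIntegrable f := by
  obtain ⟨φ, hφ⟩ := hf
  refine ⟨φ 0 1, fun ε hε => ?_⟩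
  obtain ⟨δ, hδ, hδs⟩ := UI.exists_gauge
    (e := fun e : {e : X →L[ℝ] ℝ // ‖e‖ ≤ 1} => e.1) (fun e => e.2) (fun y C h => by
      obtain ⟨e, he⟩ := exists_dual_norm_le_one y
      rw [← he]
      exact (le_abs_self _).trans (h e)) hφ.vh.aestronglyMeasurable hui (w := φ 0 1) (fun e => by
      rw [(hφ.vh.clm e.1).setIntegral_eq (hui.1 e), ← map_sub,
        ← hφ.sub_eq le_rfl zero_le_one le_rfl]) (ε := ε / 8) (by positivity)
  exact ⟨δ, hδ, fun n P hP => (hδs n P hP).trans_lt (by linarith)⟩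

theorem BddConv.mSum {Γ : ℝ → Set X} (hΓ : ∀ t ∈ Icc (0 : ℝ) 1, IsCWK X (Γ t)) {n : ℕ}
    (P : TP n) : BddConv (mSum P Γ) ∧ emb (mSum P Γ) = fSum P fun t => emb (Γ t) := by
  have h := BddConv.sum Finset.univ (A := fun i => P.len i • Γ (P.tag i))
    fun i _ => (hΓ _ (P.tagMem i)).bddConv.smul _
  refine ⟨h.1, h.2.trans (Finset.sum_congr rfl fun i _ => ?_)⟩
  exact (hΓ _ (P.tagMem i)).bddConv.emb_smul (sub_nonneg.2 (P.pt_le i))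

theorem vHPrimitive.mcShaneIntegrable {Γ : ℝ → Set X} {Φ : ℝ → ℝ → Set X} (hΦ : vHPrimitive Γ Φ)
    (hΓ : ∀ t ∈ Icc (0 : ℝ) 1, IsCWK X (Γ t))
    (hui : UI fun (e : {e : X →L[ℝ] ℝ // ‖e‖ ≤ 1}) t => coord e (emb (Γ t))) :
    McShaneIntegrable Γ := by
  have hemb := hΦ.fvHPrimitive_emb hΓ
  have h01 := hΦ.1 0 1 le_rfl zero_le_one le_rfl
  refine ⟨Φ 0 1, h01, fun ε hε => ?_⟩
  have : Nonempty {e : X →L[ℝ] ℝ // ‖e‖ ≤ 1} := ⟨⟨0, by simp⟩⟩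
  obtain ⟨δ, hδ, hδs⟩ := UI.exists_gauge (e := coord (X := X)) norm_coord_le
    (fun y C h => lp.norm_le_of_forall_le' C h) hemb.vh.aestronglyMeasurable hui
    (w := emb (Φ 0 1)) (fun e => by
      rw [(hemb.vh.clm (coord e)).setIntegral_eq (hui.1 e), ← map_sub,
        ← hemb.sub_eq le_rfl zero_le_one le_rfl]) (ε := ε / 8) (by positivity)
  refine ⟨δ, hδ, fun n P hP => ?_⟩
  obtain ⟨h1, h2⟩ := BddConv.mSum hΓ P
  rw [h01.bddConv.hausdorffDist_eq h1, h2]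
  exact (hδs n P hP).trans_lt (by linarith)

theorem McShaneIntegrable.emb {Γ : ℝ → Set X} (h : McShaneIntegrable Γ)
    (hΓ : ∀ t ∈ Icc (0 : ℝ) 1, IsCWK X (Γ t)) : FMcShaneIntegrable fun t => emb (Γ t) := by
  obtain ⟨I, hI, hIs⟩ := h
  refine ⟨GaugePaper.emb I, fun ε hε => ?_⟩
  obtain ⟨δ, hδ, hδs⟩ := hIs ε hε
  refine ⟨δ, hδ, fun n P hP => ?_⟩
  obtain ⟨h1, h2⟩ := BddConv.mSum hΓ P
  rw [← h2, ← hI.bddConv.hausdorffDist_eq h1]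
  exact hδs n P hP

end

/-- Theorem `t31` of the paper. For a variationally Henstock integrable
multifunction `Γ : [0,1] → cwk(X)` the following are equivalent: (a) every variationally
Henstock integrable selection of `Γ` is McShane integrable; (b) every variationally Henstock
integrable selection of `Γ` is Pettis integrable; (c) `Γ` has a Pettis integrable selection;
(d) `Γ` is Pettis integrable; (e) `Γ` is McShane integrable. -/
theorem vH_pettis_tfae
    {X : Type*} [NormedAddCommGroup X] [NormedSpace ℝ X] [CompleteSpace X]
    (Γ : ℝ → Set X) (hΓ : ∀ t ∈ Icc (0:ℝ) 1, IsCWK X (Γ t))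
    (h : vHIntegrable Γ) :
    List.TFAE [
      ∀ f : ℝ → X, Selection Γ f → FvHIntegrable f → FMcShaneIntegrable f,
      ∀ f : ℝ → X, Selection Γ f → FvHIntegrable f → FPettisIntegrable f,
      ∃ f : ℝ → X, Selection Γ f ∧ FPettisIntegrable f,
      PettisIntegrable Γ,
      McShaneIntegrable Γ
    ] := by
  obtain ⟨Φ, hΦ⟩ := h
  have hm := (hΦ.fvHPrimitive_emb hΓ).vh.aestronglyMeasurable
  obtain ⟨g, G, hg, hgG⟩ := hΦ.exists_selection hΓ
  tfae_have 1 → 2 := fun h1 f hf hfH => UI.fPettisIntegrable hfH.aestronglyMeasurable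
    ((h1 f hf hfH).ui hfH.aestronglyMeasurable)
  tfae_have 2 → 3 := fun h2 => ⟨g, hg, h2 g hg ⟨_, hgG.fvHPrimitive⟩⟩
  tfae_have 3 → 4 := fun ⟨_, hf, hfP⟩ => hΦ.pettisIntegrable hΓ hf hfP
  tfae_have 4 → 1 := fun h4 f hf hfH => hfH.fMcShaneIntegrable
    ((PettisIntegrable.ui_coord h4 hΓ hm).selection hΓ hf hfH.aestronglyMeasurable)
  tfae_have 4 → 5 := fun h4 => hΦ.mcShaneIntegrable hΓ (PettisIntegrable.ui_coord h4 hΓ hm)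
  tfae_have 5 → 3 := fun h5 => by
    have hu := (McShaneIntegrable.emb h5 hΓ).ui hm
    have hc : UI fun (e : {e : X →L[ℝ] ℝ // ‖e‖ ≤ 1}) t => coord e (emb (Γ t)) :=
      ⟨fun e => hu.1 ⟨coord e, norm_coord_le e⟩, fun ε hε => by
        obtain ⟨η, hη, hηs⟩ := hu.2 ε hε
        exact ⟨η, hη, fun E hE hEm hEη e => hηs E hE hEm hEη ⟨coord e, norm_coord_le e⟩⟩⟩
    have hgm := hgG.aestronglyMeasurable
    exact ⟨g, hg, UI.fPettisIntegrable hgm (hc.selection hΓ hg hgm)⟩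
  tfae_finish

end GaugePaper
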